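/- arXiv:1006.3776 — 3 statements merged into one kernel-verified Lean document; each statement's English description precedes it below -/
import Mathlib

section
/- Let G be a finite simple planar graph with maximum degree Δ(G) = 3 and girth at least 8. Then the injective chromatic number of G satisfies χ_i(G) ≤ 5. -/
open SimpleGraph

/-- An injective coloring of `G`: any two distinct vertices with a common neighbor
receive distinct colors. -/
def IsInjColoring {V α : Type*} (G : SimpleGraph V) (c : V → α) : Prop :=
  ∀ ⦃u v : V⦄, u ≠ v → (∃ w, G.Adj u w ∧ G.Adj v w) → c u ≠ c v

/-- The injective chromatic number of `G`: the least `k` such that `G` has an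
injective coloring with `k` colors. -/
noncomputable def injChromNum {V : Type*} (G : SimpleGraph V) : ℕ :=
  sInf {k | ∃ c : V → Fin k, IsInjColoring G c}
/-- A graph is planar if its vertices can be drawn as distinct points of the plane
and its edges as simple arcs joining their endpoints, such that no arc passes through
a vertex other than its endpoints, and two arcs of distinct edges meet only in common
endpoints. -/
def IsPlanar {V : Type*} (G : SimpleGraph V) : Prop :=
  ∃ (f : V → ℝ × ℝ) (γ : ∀ ⦃u v : V⦄, G.Adj u v → Path (f u) (f v)),
    Function.Injective f ∧
    (∀ ⦃u v : V⦄ (h : G.Adj u v), Function.Injective ⇑(γ h)) ∧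
    (∀ ⦃u v : V⦄ (h : G.Adj u v), Set.range ⇑(γ h.symm) = Set.range ⇑(γ h)) ∧
    (∀ ⦃u v : V⦄ (h : G.Adj u v) (w : V), f w ∈ Set.range ⇑(γ h) → w = u ∨ w = v) ∧
    (∀ ⦃u v x y : V⦄ (h₁ : G.Adj u v) (h₂ : G.Adj x y), s(u, v) ≠ s(x, y) →
      Set.range ⇑(γ h₁) ∩ Set.range ⇑(γ h₂) ⊆ ({f u, f v} : Set (ℝ × ℝ)) ∩ {f x, f y})

/-- MacLane's condition on a binary code: it is spanned by finitely many words such that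
every coordinate is used by at most two of them. -/
def IsMacLane {E : Type*} (Z : Submodule (ZMod 2) (E →₀ ZMod 2)) : Prop :=
  ∃ s : Finset (E →₀ ZMod 2), Submodule.span (ZMod 2) (s : Set (E →₀ ZMod 2)) = Z ∧
    ∀ e, {x ∈ s | x e ≠ 0}.card ≤ 2

theorem ZMod.eq_one_of_ne_zero {a : ZMod 2} (h : a ≠ 0) : a = 1 := by
  revert a; decide

theorem IsMacLane.inf_ker {E : Type*} {Z : Submodule (ZMod 2) (E →₀ ZMod 2)}
    (h : IsMacLane Z) (e : E) :
    IsMacLane (Z ⊓ LinearMap.ker (Finsupp.lapply e : (E →₀ ZMod 2) →ₗ[ZMod 2] ZMod 2)) := by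
  classical
  obtain ⟨s, hs, hc⟩ := h
  by_cases hT : ∃ b ∈ s, b e ≠ 0
  · obtain ⟨b, hbs, hbe⟩ := hT
    have hbe1 := ZMod.eq_one_of_ne_zero hbe
    let φ : (E →₀ ZMod 2) →ₗ[ZMod 2] (E →₀ ZMod 2) :=
      LinearMap.id + (Finsupp.lapply e : (E →₀ ZMod 2) →ₗ[ZMod 2] ZMod 2).smulRight b
    have hφ (x) : φ x = x + x e • b := rfl
    refine ⟨s.image φ, ?_, ?_⟩
    · rw [Finset.coe_image, ← Submodule.map_span, hs]
      apply le_antisymm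
      · rintro _ ⟨x, hx, rfl⟩
        refine ⟨Z.add_mem hx (Z.smul_mem _ (hs ▸ Submodule.subset_span hbs)), ?_⟩
        simp [hφ, hbe1, CharTwo.add_self_eq_zero]
      · rintro x ⟨hx, hxe⟩
        refine ⟨x, hx, ?_⟩
        have : x e = 0 := hxe
        simp [hφ, this]
    · intro e'
      obtain ⟨b₂, hb₂⟩ : ∃ b₂, ∀ x ∈ s, x e ≠ 0 → x = b ∨ x = b₂ := by
        have h2 := hc e
        by_contra! hcon
        obtain ⟨x, hx, hxe, hxb, -⟩ := hcon b
        obtain ⟨y, hy, hye, hyb, hyx⟩ := hcon x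
        have : ({b, x, y} : Finset _) ⊆ {x ∈ s | x e ≠ 0} := by
          intro w
          simp only [Finset.mem_insert, Finset.mem_singleton, Finset.mem_filter]
          rintro (rfl | rfl | rfl) <;> simp_all
        have h3 := Finset.card_le_card this
        rw [Finset.card_eq_three.2 ⟨b, x, y, hxb.symm, hyb.symm, hyx.symm, rfl⟩] at h3
        omega
      refine le_trans (le_trans (Finset.card_le_card
        (t := ({x ∈ s | x e' ≠ 0}).image (fun x => if x e ≠ 0 then b + b₂ else x)) ?_)
        Finset.card_image_le) (hc e')
      intro y hy
      rw [Finset.mem_filter, Finset.mem_image] at hy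
      obtain ⟨⟨x, hx, rfl⟩, hy⟩ := hy
      rw [Finset.mem_image]
      by_cases hxe : x e = 0
      · refine ⟨x, ?_, ?_⟩
        · simpa [hφ, hxe, hx] using hy
        · simp [hφ, hxe]
      · have hxe1 := ZMod.eq_one_of_ne_zero hxe
        have hxb : x ≠ b := by
          rintro rfl
          apply hy
          simp [hφ, hxe1, CharTwo.add_self_eq_zero]
        have hx2 : x = b₂ := (hb₂ x hx hxe).resolve_left hxb
        have hy' : b e' + x e' ≠ 0 := by
          simpa [hφ, hxe1, add_comm] using hy
        by_cases hb' : b e' = 0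
        · refine ⟨x, ?_, ?_⟩
          · simpa [hb', hx] using hy'
          · simp [hφ, hxe1, ← hx2, add_comm]
        · refine ⟨b, by simp [hbs, hb'], ?_⟩
          simp [hφ, hbe, hxe1, ← hx2, add_comm]
  · push Not at hT
    refine ⟨s, ?_, hc⟩
    rw [hs, eq_comm, inf_eq_left, ← hs, Submodule.span_le]
    intro x hx
    exact hT x hx

theorem IsMacLane.inf_vanish {E : Type*} {Z : Submodule (ZMod 2) (E →₀ ZMod 2)}
    (h : IsMacLane Z) (D : Finset E) :
    ∃ Z' : Submodule (ZMod 2) (E →₀ ZMod 2), IsMacLane Z' ∧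
      ∀ z, z ∈ Z' ↔ z ∈ Z ∧ ∀ e ∈ D, z e = 0 := by
  classical
  induction D using Finset.induction_on with
  | empty => exact ⟨Z, h, by simp⟩
  | insert e D _ ih =>
    obtain ⟨Z', hZ', hmem⟩ := ih
    refine ⟨_, hZ'.inf_ker e, fun z => ?_⟩
    rw [Submodule.mem_inf, hmem, LinearMap.mem_ker, Finsupp.lapply_apply]
    simp only [Finset.forall_mem_insert]
    tauto

theorem IsMacLane.comapDomain {E J : Type*} {Z : Submodule (ZMod 2) (E →₀ ZMod 2)}
    (h : IsMacLane Z) (ι : J → E) (hι : Function.Injective ι) :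
    IsMacLane (Z.map (Finsupp.lcomapDomain ι hι)) := by
  classical
  obtain ⟨s, hs, hc⟩ := h
  refine ⟨s.image (Finsupp.lcomapDomain ι hι : (E →₀ ZMod 2) →ₗ[ZMod 2] _), ?_, fun j => ?_⟩
  · rw [Finset.coe_image, ← Submodule.map_span, hs]
  · rw [Finset.filter_image]
    exact Finset.card_image_le.trans (hc (ι j))

/-- If all nonzero words of a nonzero code satisfying MacLane's condition have weight at
least `g`, then the dimension of the code is small compared with its length. -/
theorem IsMacLane.mul_finrank_succ_le {J : Type*} [Fintype J]
    {Z : Submodule (ZMod 2) (J →₀ ZMod 2)} (h : IsMacLane Z) (g : ℕ)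
    (hg : ∀ z ∈ Z, z ≠ 0 → g ≤ z.support.card) (hpos : 0 < Module.finrank (ZMod 2) Z) :
    g * (Module.finrank (ZMod 2) Z + 1) ≤ 2 * Fintype.card J := by
  classical
  obtain ⟨s, hs, hc⟩ := h
  obtain ⟨b, hbs, hbspan, hbli⟩ := exists_linearIndependent (ZMod 2) (s : Set (J →₀ ZMod 2))
  lift b to Finset (J →₀ ZMod 2) using s.finite_toSet.subset hbs
  rw [Finset.coe_subset] at hbs
  rw [hs] at hbspan
  have hcard : Module.finrank (ZMod 2) Z = b.card := by
    rw [← hbspan]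
    exact (finrank_span_finset_eq_card hbli)
  have hbZ : ∀ x ∈ b, x ∈ Z := fun x hx => hbspan ▸ Submodule.subset_span hx
  have hsum : ∑ x ∈ b, x ≠ 0 := by
    intro h0
    have hbne : b.Nonempty := Finset.card_pos.1 (hcard ▸ hpos)
    obtain ⟨x, hx⟩ := hbne
    have := linearIndependent_iff'.1 hbli Finset.univ (fun _ => 1) (by
      simpa using (Finset.sum_coe_sort b (fun x => x)).trans h0) ⟨x, hx⟩ (Finset.mem_univ _)
    exact one_ne_zero this
  have h1 : g * (b.card + 1) ≤ ∑ x ∈ b, x.support.card + (∑ x ∈ b, x).support.card := by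
    rw [mul_add, mul_one, mul_comm]
    refine add_le_add ?_ (hg _ (Z.sum_mem hbZ) hsum)
    rw [← smul_eq_mul]
    exact Finset.card_nsmul_le_sum _ _ _ fun x hx => hg x (hbZ x hx) (by
      simpa using hbli.ne_zero ⟨x, hx⟩)
  have h2 : ∑ x ∈ b, x.support.card + (∑ x ∈ b, x).support.card
      = ∑ j : J, ({x ∈ b | x j ≠ 0}.card + if (∑ x ∈ b, x) j ≠ 0 then 1 else 0) := by
    rw [Finset.sum_add_distrib]
    congr 1
    · have (x : J →₀ ZMod 2) : x.support.card = ∑ j : J, if x j ≠ 0 then 1 else 0 := by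
        rw [← Finset.card_filter]
        congr 1; ext j; simp
      simp_rw [this, Finset.card_filter]
      exact Finset.sum_comm
    · rw [← Finset.card_filter]
      congr 1; ext j; simp
  rw [hcard]
  refine h1.trans (h2.le.trans ?_)
  calc _ ≤ ∑ _j : J, 2 := Finset.sum_le_sum fun j _ => ?_
    _ = _ := by simp [mul_comm]
  have hle : {x ∈ b | x j ≠ 0}.card ≤ 2 :=
    (Finset.card_le_card (Finset.filter_subset_filter _ hbs)).trans (hc j)
  have heq : (∑ x ∈ b, x) j = ({x ∈ b | x j ≠ 0}.card : ZMod 2) := by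
    rw [Finsupp.finsetSum_apply, Finset.card_filter, Nat.cast_sum]
    refine Finset.sum_congr rfl fun x _ => ?_
    split_ifs with hx
    · simpa using ZMod.eq_one_of_ne_zero hx
    · simpa using hx
  rw [heq]
  generalize {x ∈ b | x j ≠ 0}.card = n at hle
  interval_cases n <;> decide

/-- The mod-2 boundary map of the multigraph whose edge `e` joins `a e` and `b e`. -/
noncomputable def bdry {E V : Type*} (a b : E → V) : (E →₀ ZMod 2) →ₗ[ZMod 2] (V →₀ ZMod 2) :=
  Finsupp.linearCombination (ZMod 2) fun e => Finsupp.single (a e) 1 + Finsupp.single (b e) 1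

theorem bdry_single {E V : Type*} (a b : E → V) (e : E) (c : ZMod 2) :
    bdry a b (Finsupp.single e c) = c • (Finsupp.single (a e) 1 + Finsupp.single (b e) 1) := by
  simp [bdry]

/-- An endpoint of an edge of the square grid: `(p, false)` is the edge to the right of `p`
and `(p, true)` the edge above `p`. -/
def gridTail (e : (ℤ × ℤ) × Bool) : ℤ × ℤ := e.1

/-- The endpoint of a grid edge other than `gridTail`. -/
def gridHead (e : (ℤ × ℤ) × Bool) : ℤ × ℤ :=
  if e.2 then (e.1.1, e.1.2 + 1) else (e.1.1 + 1, e.1.2)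

theorem bdry_grid_apply (z : (ℤ × ℤ) × Bool →₀ ZMod 2) (i j : ℤ) :
    bdry gridTail gridHead z (i, j) =
      z ((i, j), false) + z ((i - 1, j), false) + z ((i, j), true) + z ((i, j - 1), true) := by
  induction z using Finsupp.induction_linear with
  | zero => simp
  | add f g hf hg =>
    rw [map_add, Finsupp.add_apply, hf, hg]
    simp only [Finsupp.add_apply]
    ring
  | single e c =>
    obtain ⟨⟨x, y⟩, d⟩ := e
    rw [bdry_single]
    have h1 : x + 1 = i ↔ x = i - 1 := by omega
    have h2 : y + 1 = j ↔ y = j - 1 := by omega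
    cases d <;>
    simp [gridTail, gridHead, Finsupp.single_apply, h1, h2]

/-- The boundary of the unit square with lower left corner `p`. -/
noncomputable def gridSquare (p : ℤ × ℤ) : (ℤ × ℤ) × Bool →₀ ZMod 2 :=
  Finsupp.single (p, false) 1 + Finsupp.single ((p.1, p.2 + 1), false) 1 +
    Finsupp.single (p, true) 1 + Finsupp.single ((p.1 + 1, p.2), true) 1

theorem gridSquare_apply_false (p : ℤ × ℤ) (i j : ℤ) :
    gridSquare p ((i, j), false) =
      (if p = (i, j) then 1 else 0) + (if p = (i, j - 1) then 1 else 0) := by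
  obtain ⟨x, y⟩ := p
  have h2 : y + 1 = j ↔ y = j - 1 := by omega
  simp [gridSquare, Finsupp.single_apply, h2]

theorem gridSquare_apply_true (p : ℤ × ℤ) (i j : ℤ) :
    gridSquare p ((i, j), true) =
      (if p = (i, j) then 1 else 0) + (if p = (i - 1, j) then 1 else 0) := by
  obtain ⟨x, y⟩ := p
  have h2 : x + 1 = i ↔ x = i - 1 := by omega
  simp [gridSquare, Finsupp.single_apply, h2]

theorem bdry_gridSquare (p : ℤ × ℤ) : bdry gridTail gridHead (gridSquare p) = 0 := by
  ext ⟨i, j⟩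
  rw [bdry_grid_apply]
  simp only [gridSquare_apply_false, gridSquare_apply_true, Finsupp.coe_zero, Pi.zero_apply]
  generalize (if p = (i, j) then (1 : ZMod 2) else 0) = a
  generalize (if p = (i - 1, j) then (1 : ZMod 2) else 0) = b
  generalize (if p = (i, j - 1) then (1 : ZMod 2) else 0) = c
  generalize (if p = (i - 1, j - 1) then (1 : ZMod 2) else 0) = d
  revert a b c d
  decide

theorem mem_span_gridSquare (n : ℤ) (z : (ℤ × ℤ) × Bool →₀ ZMod 2)
    (hz : bdry gridTail gridHead z = 0)
    (hout : ∀ i j d, z ((i, j), d) ≠ 0 → -n ≤ i ∧ i < n ∧ -n ≤ j ∧ j < n) :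
    z ∈ Submodule.span (ZMod 2)
      (gridSquare '' (Finset.Icc (-n) n ×ˢ Finset.Icc (-n) n : Finset (ℤ × ℤ))) := by
  classical
  have hcyc (i j) : z ((i, j), false) + z ((i - 1, j), false) + z ((i, j), true) +
      z ((i, j - 1), true) = 0 := by
    rw [← bdry_grid_apply, hz]; rfl
  have hz0 (i j d) (h : ¬ (-n ≤ i ∧ i < n ∧ -n ≤ j ∧ j < n)) : z ((i, j), d) = 0 := by
    by_contra h'
    exact h (hout i j d h')
  let W (i j : ℤ) : ZMod 2 := ∑ k ∈ Finset.Icc (-n) i, z ((k, j), true)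
  have hWi (i j) (h : i < -n) : W i j = 0 := by
    simp [W, Finset.Icc_eq_empty_of_lt h]
  have hWj (i j) (h : ¬ (-n ≤ j ∧ j < n)) : W i j = 0 :=
    Finset.sum_eq_zero fun k _ => hz0 _ _ _ (by tauto)
  have hstep (i j) : W i j = W (i - 1) j + z ((i, j), true) := by
    by_cases h : i < -n
    · rw [hWi i j h, hWi _ j (by omega), hz0 _ _ _ (by omega), add_zero]
    · have : Finset.Icc (-n) i = insert i (Finset.Icc (-n) (i - 1)) := by
        ext k; simp only [Finset.mem_Icc, Finset.mem_insert]; omega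
      simp only [W]
      rw [this, Finset.sum_insert (by simp), add_comm]
  have hrow (i j) : W i j + W i (j - 1) = z ((i, j), false) := by
    by_cases h : i < -n
    · rw [hWi i j h, hWi _ _ h, hz0 _ _ _ (by omega), add_zero]
    · induction i, (show -n - 1 ≤ i by omega) using Int.leInduction with
      | base => rw [hWi _ _ (by omega), hWi _ _ (by omega), hz0 _ _ _ (by omega), add_zero]
      | succ k hk ih =>
        have ih' : W k j + W k (j - 1) = z ((k, j), false) := by
          by_cases h' : k < -n
          · rw [hWi k j h', hWi _ _ h', hz0 _ _ _ (by omega), add_zero]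
          · exact ih h'
        have hc := hcyc (k + 1) j
        rw [hstep, hstep (k + 1) (j - 1)]
        rw [add_sub_cancel_right] at hc ⊢
        rw [← ih'] at hc
        revert hc
        generalize W k j = a
        generalize W k (j - 1) = b
        generalize z ((k + 1, j), true) = c
        generalize z ((k + 1, j - 1), true) = d
        generalize z ((k + 1, j), false) = e
        revert a b c d e
        decide
  have hWn (i j) (h : n ≤ i) : W i j = 0 := by
    by_cases hj : j < -n
    · exact hWj _ _ (by omega)
    · induction j, (show -n - 1 ≤ j by omega) using Int.leInduction with
      | base => exact hWj _ _ (by omega)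
      | succ k hk ih =>
        have ih' : W i k = 0 := by
          by_cases h' : k < -n
          · exact hWj _ _ (by omega)
          · exact ih h'
        have := hrow i (k + 1)
        rwa [add_sub_cancel_right, ih', add_zero, hz0 _ _ _ (by omega)] at this
  have hW0 (q : ℤ × ℤ) (h : q ∉ (Finset.Icc (-n) n ×ˢ Finset.Icc (-n) n : Finset (ℤ × ℤ))) :
      W q.1 q.2 = 0 := by
    simp only [Finset.mem_product, Finset.mem_Icc] at h
    by_cases h1 : q.1 < -n
    · exact hWi _ _ h1
    by_cases h2 : n ≤ q.1
    · exact hWn _ _ h2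
    exact hWj _ _ (by omega)
  have key : z = ∑ p ∈ Finset.Icc (-n) n ×ˢ Finset.Icc (-n) n, W p.1 p.2 • gridSquare p := by
    have hsum (q : ℤ × ℤ) : ∑ p ∈ Finset.Icc (-n) n ×ˢ Finset.Icc (-n) n,
        W p.1 p.2 * (if p = q then 1 else 0) = W q.1 q.2 := by
      simp only [mul_ite, mul_one, mul_zero, Finset.sum_ite_eq']
      split_ifs with h
      · rfl
      · exact (hW0 q h).symm
    ext ⟨⟨i, j⟩, d⟩
    rw [Finsupp.finsetSum_apply]
    cases d
    · simp only [Finsupp.smul_apply, gridSquare_apply_false, smul_eq_mul, mul_add,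
        Finset.sum_add_distrib]
      rw [hsum, hsum, hrow]
    · simp only [Finsupp.smul_apply, gridSquare_apply_true, smul_eq_mul, mul_add,
        Finset.sum_add_distrib]
      rw [hsum, hsum, hstep]
      dsimp only
      rw [add_right_comm, CharTwo.add_self_eq_zero, zero_add]
  rw [key]
  exact Submodule.sum_mem _ fun p hp =>
    Submodule.smul_mem _ _ (Submodule.subset_span ⟨p, hp, rfl⟩)

/-- The cycle space of every finite subgraph of the square grid satisfies MacLane's
condition. -/
theorem isMacLane_grid (A : Finset ((ℤ × ℤ) × Bool)) :
    ∃ Z : Submodule (ZMod 2) ((ℤ × ℤ) × Bool →₀ ZMod 2), IsMacLane Z ∧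
      ∀ z, z ∈ Z ↔ bdry gridTail gridHead z = 0 ∧ ∀ e ∉ A, z e = 0 := by
  classical
  obtain ⟨n, hn⟩ : ∃ n : ℤ, ∀ e ∈ A, -n ≤ e.1.1 ∧ e.1.1 < n ∧ -n ≤ e.1.2 ∧ e.1.2 < n := by
    refine ⟨∑ e ∈ A, (|e.1.1| + |e.1.2| + 1), fun e he => ?_⟩
    have := Finset.single_le_sum (f := fun e : (ℤ × ℤ) × Bool => |e.1.1| + |e.1.2| + 1)
      (fun e _ => by positivity) he
    have h1 := abs_le.1 (le_refl |e.1.1|)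
    have h2 := abs_le.1 (le_refl |e.1.2|)
    have h3 := abs_nonneg e.1.1
    have h4 := abs_nonneg e.1.2
    omega
  let box : Finset (ℤ × ℤ) := Finset.Icc (-n) n ×ˢ Finset.Icc (-n) n
  let s := box.image gridSquare
  have hs : IsMacLane (Submodule.span (ZMod 2) (s : Set ((ℤ × ℤ) × Bool →₀ ZMod 2))) := by
    refine ⟨s, rfl, ?_⟩
    rintro ⟨⟨i, j⟩, d⟩
    refine (Finset.card_le_card (t := {gridSquare (i, j),
      gridSquare (if d then (i - 1, j) else (i, j - 1))}) ?_).trans Finset.card_le_two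
    intro x hx
    rw [Finset.mem_filter, Finset.mem_image] at hx
    obtain ⟨⟨p, -, rfl⟩, hp⟩ := hx
    rw [Finset.mem_insert, Finset.mem_singleton]
    by_contra! hne
    have h1 : p ≠ (i, j) := fun h => hne.1 (by rw [h])
    have h2 : p ≠ if d then (i - 1, j) else (i, j - 1) := fun h => hne.2 (by rw [h])
    cases d
    · rw [gridSquare_apply_false, if_neg h1, if_neg (by simpa using h2)] at hp
      simp at hp
    · rw [gridSquare_apply_true, if_neg h1, if_neg (by simpa using h2)] at hp
      simp at hp
  obtain ⟨Z, hZ, hmem⟩ := hs.inf_vanish ((s.biUnion Finsupp.support) \ A)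
  refine ⟨Z, hZ, fun z => ?_⟩
  rw [hmem]
  constructor
  · rintro ⟨hz, hD⟩
    constructor
    · have : Submodule.span (ZMod 2) (s : Set ((ℤ × ℤ) × Bool →₀ ZMod 2)) ≤
          LinearMap.ker (bdry gridTail gridHead) := by
        rw [Submodule.span_le]
        intro x hx
        obtain ⟨p, -, rfl⟩ := Finset.mem_image.1 hx
        exact bdry_gridSquare p
      exact this hz
    · intro e he
      by_cases h : e ∈ s.biUnion Finsupp.support
      · exact hD e (Finset.mem_sdiff.2 ⟨h, he⟩)
      · have : Submodule.span (ZMod 2) (s : Set ((ℤ × ℤ) × Bool →₀ ZMod 2)) ≤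
            LinearMap.ker (Finsupp.lapply e : (_ →₀ ZMod 2) →ₗ[ZMod 2] ZMod 2) := by
          rw [Submodule.span_le]
          intro x hx
          by_contra hxe
          exact h (Finset.mem_biUnion.2 ⟨x, hx, Finsupp.mem_support_iff.2 hxe⟩)
        exact this hz
  · rintro ⟨hz, hA⟩
    refine ⟨?_, fun e he => hA e (Finset.mem_sdiff.1 he).2⟩
    have := mem_span_gridSquare n z hz fun i j d h => hn ((i, j), d) (by
      by_contra h'
      exact h (hA _ h'))
    simpa [s, box] using this

theorem finsupp_zmod_two_add_self {E : Type*} (x : E →₀ ZMod 2) : x + x = 0 := by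
  ext e
  simp [CharTwo.add_self_eq_zero]

/-- `p` and `q` are the endpoints of a grid edge inside `S`. -/
def GridStep (S : Set (ℤ × ℤ)) (p q : ℤ × ℤ) : Prop :=
  p ∈ S ∧ q ∈ S ∧ ∃ e, (gridTail e = p ∧ gridHead e = q) ∨ (gridTail e = q ∧ gridHead e = p)

/-- `p` and `q` are joined by a lattice path inside `S`. -/
def GridReach (S : Set (ℤ × ℤ)) : ℤ × ℤ → ℤ × ℤ → Prop :=
  Relation.ReflTransGen (GridStep S)

theorem GridReach.exists_chain {S : Set (ℤ × ℤ)} {p q : ℤ × ℤ} (h : GridReach S p q) :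
    ∃ κ : (ℤ × ℤ) × Bool →₀ ZMod 2,
      bdry gridTail gridHead κ = Finsupp.single p 1 + Finsupp.single q 1 ∧
      ∀ e, κ e ≠ 0 → gridTail e ∈ S ∧ gridHead e ∈ S := by
  classical
  induction h with
  | refl => exact ⟨0, by rw [map_zero, finsupp_zmod_two_add_self], by simp⟩
  | @tail x y _ hxy ih =>
    obtain ⟨κ, hκ, hS⟩ := ih
    obtain ⟨hx, hy, e, he⟩ := hxy
    refine ⟨κ + Finsupp.single e 1, ?_, fun e' he' => ?_⟩
    · have : Finsupp.single (gridTail e) (1 : ZMod 2) + Finsupp.single (gridHead e) 1 =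
          Finsupp.single x 1 + Finsupp.single y 1 := by
        rcases he with ⟨rfl, rfl⟩ | ⟨rfl, rfl⟩
        · rfl
        · exact add_comm _ _
      rw [map_add, hκ, bdry_single, one_smul, this, add_assoc, ← add_assoc (Finsupp.single x _),
        finsupp_zmod_two_add_self, zero_add]
    · by_cases h : e = e'
      · subst h
        rcases he with ⟨rfl, rfl⟩ | ⟨rfl, rfl⟩
        · exact ⟨hx, hy⟩
        · exact ⟨hy, hx⟩
      · apply hS
        simpa [Finsupp.single_apply, h] using he'

/-- The cycle space of a minor of the square grid satisfies MacLane's condition. -/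
theorem isMacLane_of_gridMinor {V J : Type*} [Finite V] [Finite J] (a b : J → V)
    (hab : ∀ j, a j ≠ b j) (S : V → Set (ℤ × ℤ)) (hfin : ∀ v, (S v).Finite)
    (hdisj : ∀ u v p, p ∈ S u → p ∈ S v → u = v) (base : V → ℤ × ℤ)
    (hconn : ∀ v, ∀ p ∈ S v, GridReach (S v) p (base v))
    (ι : J → (ℤ × ℤ) × Bool) (hι : Function.Injective ι)
    (hend : ∀ j, (gridTail (ι j) ∈ S (a j) ∧ gridHead (ι j) ∈ S (b j)) ∨
      (gridTail (ι j) ∈ S (b j) ∧ gridHead (ι j) ∈ S (a j))) :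
    IsMacLane (LinearMap.ker (bdry a b)) := by
  classical
  let inner : Set ((ℤ × ℤ) × Bool) := {e | ∃ v, gridTail e ∈ S v ∧ gridHead e ∈ S v}
  have hinner : inner.Finite := by
    refine ((Set.finite_iUnion hfin).prod (Set.finite_univ (α := Bool))).subset ?_
    rintro e ⟨v, hv, -⟩
    exact ⟨Set.mem_iUnion.2 ⟨v, hv⟩, trivial⟩
  have hA : (inner ∪ Set.range ι).Finite := hinner.union (Set.finite_range ι)
  have hnot (j : J) (v : V) : ¬ (gridTail (ι j) ∈ S v ∧ gridHead (ι j) ∈ S v) := by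
    rintro ⟨h1, h2⟩
    apply hab j
    rcases hend j with ⟨h3, h4⟩ | ⟨h3, h4⟩
    · rw [hdisj _ _ _ h3 h1, hdisj _ _ _ h4 h2]
    · rw [hdisj _ _ _ h3 h1, hdisj _ _ _ h4 h2]
  obtain ⟨Z, hZ, hmem⟩ := isMacLane_grid hA.toFinset
  suffices LinearMap.ker (bdry a b) = Z.map (Finsupp.lcomapDomain ι hι) by
    rw [this]
    exact hZ.comapDomain ι hι
  apply le_antisymm
  · have hκ (p : ℤ × ℤ) : ∃ κ : (ℤ × ℤ) × Bool →₀ ZMod 2, ∀ v, p ∈ S v →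
        bdry gridTail gridHead κ = Finsupp.single p 1 + Finsupp.single (base v) 1 ∧
        ∀ e, κ e ≠ 0 → gridTail e ∈ S v ∧ gridHead e ∈ S v := by
      by_cases h : ∃ v, p ∈ S v
      · obtain ⟨v, hv⟩ := h
        obtain ⟨κ, h1, h2⟩ := (hconn v p hv).exists_chain
        refine ⟨κ, fun w hw => ?_⟩
        rw [← hdisj _ _ _ hv hw]
        exact ⟨h1, h2⟩
      · exact ⟨0, fun v hv => (h ⟨v, hv⟩).elim⟩
    choose κ hκ using hκ
    have hends (j) : ∃ v w, gridTail (ι j) ∈ S v ∧ gridHead (ι j) ∈ S w ∧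
        Finsupp.single (a j) (1 : ZMod 2) + Finsupp.single (b j) 1 =
          Finsupp.single v 1 + Finsupp.single w 1 := by
      rcases hend j with ⟨h3, h4⟩ | ⟨h3, h4⟩
      · exact ⟨_, _, h3, h4, rfl⟩
      · exact ⟨_, _, h3, h4, add_comm _ _⟩
    let L : (J →₀ ZMod 2) →ₗ[ZMod 2] ((ℤ × ℤ) × Bool →₀ ZMod 2) :=
      Finsupp.linearCombination (ZMod 2) fun j =>
        Finsupp.single (ι j) 1 + κ (gridTail (ι j)) + κ (gridHead (ι j))
    have hL (j) : L (Finsupp.single j 1) =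
        Finsupp.single (ι j) 1 + κ (gridTail (ι j)) + κ (gridHead (ι j)) := by simp [L]
    have hbL : bdry gridTail gridHead ∘ₗ L = Finsupp.lmapDomain _ _ base ∘ₗ bdry a b := by
      ext1 j
      apply LinearMap.ext_ring
      obtain ⟨v, w, hv, hw, hvw⟩ := hends j
      simp only [LinearMap.comp_apply, Finsupp.lsingle_apply]
      rw [hL, map_add, map_add, bdry_single, bdry_single, one_smul, one_smul, hvw, map_add,
        (hκ _ v hv).1, (hκ _ w hw).1]
      simp only [Finsupp.lmapDomain_apply, Finsupp.mapDomain_single]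
      generalize Finsupp.single (gridTail (ι j)) (1 : ZMod 2) = t
      generalize Finsupp.single (gridHead (ι j)) (1 : ZMod 2) = h
      rw [show ∀ x y : ℤ × ℤ →₀ ZMod 2, t + h + (t + x) + (h + y) = (t + t) + (h + h) + (x + y) by
        intros; abel, finsupp_zmod_two_add_self, finsupp_zmod_two_add_self]
      simp
    have hκι (p j) (hp : ∃ v, p ∈ S v) : κ p (ι j) = 0 := by
      by_contra h
      obtain ⟨v, hv⟩ := hp
      exact hnot j v ((hκ p v hv).2 _ h)
    have hκA (p e) (hp : ∃ v, p ∈ S v) (he : e ∉ hA.toFinset) : κ p e = 0 := by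
      by_contra h
      obtain ⟨v, hv⟩ := hp
      exact he (hA.mem_toFinset.2 (Or.inl ⟨v, (hκ p v hv).2 _ h⟩))
    intro y hy
    refine ⟨L y, (hmem _).2 ⟨?_, fun e he => ?_⟩, ?_⟩
    · have := LinearMap.congr_fun hbL y
      rw [LinearMap.comp_apply, LinearMap.comp_apply, LinearMap.mem_ker.1 hy, map_zero] at this
      exact this
    · have : (Finsupp.lapply e : (_ →₀ ZMod 2) →ₗ[ZMod 2] ZMod 2) ∘ₗ L = 0 := by
        ext1 j
        apply LinearMap.ext_ring
        obtain ⟨v, w, hv, hw, -⟩ := hends j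
        have hne : ι j ≠ e := by
          rintro rfl
          exact he (hA.mem_toFinset.2 (Or.inr ⟨j, rfl⟩))
        simp [hL, hκA _ e ⟨v, hv⟩ he, hκA _ e ⟨w, hw⟩ he, hne]
      exact LinearMap.congr_fun this y
    · have : (Finsupp.lcomapDomain ι hι : (_ →₀ ZMod 2) →ₗ[ZMod 2] _) ∘ₗ L = LinearMap.id := by
        ext1 j
        apply LinearMap.ext_ring
        obtain ⟨v, w, hv, hw, -⟩ := hends j
        ext j'
        have h1 := hκι _ j' ⟨v, hv⟩
        have h2 := hκι _ j' ⟨w, hw⟩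
        simp [hL, h1, h2, Finsupp.single_apply, hι.eq_iff, Finsupp.lcomapDomain]
      exact LinearMap.congr_fun this y
  · have hπ : ∃ π : ℤ × ℤ → V →₀ ZMod 2, ∀ v, ∀ p ∈ S v, π p = Finsupp.single v 1 := by
      refine ⟨fun p => if h : ∃ v, p ∈ S v then Finsupp.single h.choose 1 else 0, ?_⟩
      intro v p hp
      have h : ∃ v, p ∈ S v := ⟨v, hp⟩
      dsimp only
      rw [dif_pos h, hdisj _ _ _ h.choose_spec hp]
    obtain ⟨π, hπ⟩ := hπ
    have key (z : (ℤ × ℤ) × Bool →₀ ZMod 2)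
        (hz : z ∈ Finsupp.supported (ZMod 2) (ZMod 2) (inner ∪ Set.range ι)) :
        bdry a b ((Finsupp.lcomapDomain ι hι : (_ →₀ ZMod 2) →ₗ[ZMod 2] _) z) =
          Finsupp.linearCombination (ZMod 2) π (bdry gridTail gridHead z) := by
      rw [Finsupp.supported_eq_span_single] at hz
      induction hz using Submodule.span_induction with
      | zero => simp
      | add x y _ _ hx hy => rw [map_add, map_add, hx, hy, map_add, map_add]
      | smul c x _ hx => rw [map_smul, map_smul, hx, map_smul, map_smul]
      | mem x hx =>
        obtain ⟨e, he, rfl⟩ := hx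
        rw [bdry_single, one_smul, map_add, Finsupp.linearCombination_single,
          Finsupp.linearCombination_single, one_smul, one_smul]
        by_cases hej : ∃ j, ι j = e
        · obtain ⟨j, rfl⟩ := hej
          have : (Finsupp.lcomapDomain ι hι : (_ →₀ ZMod 2) →ₗ[ZMod 2] J →₀ ZMod 2)
              (Finsupp.single (ι j) 1) = Finsupp.single j 1 := by
            ext j'
            simp [Finsupp.single_apply, Finsupp.lcomapDomain]
          rw [this, bdry_single, one_smul]
          rcases hend j with ⟨h3, h4⟩ | ⟨h3, h4⟩
          · rw [hπ _ _ h3, hπ _ _ h4]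
          · rw [hπ _ _ h3, hπ _ _ h4, add_comm]
        · have : (Finsupp.lcomapDomain ι hι : (_ →₀ ZMod 2) →ₗ[ZMod 2] J →₀ ZMod 2)
              (Finsupp.single e 1) = 0 := by
            ext j'
            have : e ≠ ι j' := fun h => hej ⟨j', h.symm⟩
            simp [Finsupp.lcomapDomain, this.symm]
          rw [this, map_zero]
          obtain ⟨v, h3, h4⟩ := he.resolve_right hej
          rw [hπ _ _ h3, hπ _ _ h4, finsupp_zmod_two_add_self]
    rintro _ ⟨z, hz, rfl⟩
    obtain ⟨hz1, hz2⟩ := (hmem z).1 hz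
    rw [LinearMap.mem_ker, key z, hz1, map_zero]
    rw [Finsupp.mem_supported]
    intro e he
    by_contra h
    exact Finsupp.mem_support_iff.1 he (hz2 e (fun h' => h (hA.mem_toFinset.1 h')))

/-- A nonzero mod-2 cycle of a graph has at least as many edges as the girth. -/
theorem le_card_support_of_bdry_eq_zero {V : Type*} (G : SimpleGraph V) (g : ℕ)
    (hg : (g : ℕ∞) ≤ G.egirth) (a b : G.edgeSet → V) (hab : ∀ j, s(a j, b j) = j.1)
    (z : G.edgeSet →₀ ZMod 2) (hz : bdry a b z = 0) (hne : z ≠ 0) : g ≤ z.support.card := by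
  classical
  let H : SimpleGraph V := SimpleGraph.fromEdgeSet (Subtype.val '' (z.support : Set G.edgeSet))
  have hadj (j : G.edgeSet) : G.Adj (a j) (b j) := by
    rw [← SimpleGraph.mem_edgeSet, hab]
    exact j.2
  have hHG : H ≤ G := by
    intro u v huv
    obtain ⟨⟨j, -, hj⟩, -⟩ := SimpleGraph.fromEdgeSet_adj _ |>.1 huv
    rw [← SimpleGraph.mem_edgeSet, ← hj]
    exact j.2
  have hH (j : G.edgeSet) (hj : z j ≠ 0) : H.Adj (a j) (b j) := by
    rw [SimpleGraph.fromEdgeSet_adj]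
    exact ⟨⟨j, by simpa using hj, (hab j).symm⟩, (hadj j).ne⟩
  by_cases hac : H.IsAcyclic
  · exfalso
    obtain ⟨j₀, hj₀⟩ := Finsupp.ne_iff.1 hne
    rw [Finsupp.coe_zero, Pi.zero_apply] at hj₀
    have hbr := SimpleGraph.isAcyclic_iff_forall_adj_isBridge.1 hac (hH j₀ hj₀)
    rw [SimpleGraph.isBridge_iff] at hbr
    let K := H.deleteEdges {s(a j₀, b j₀)}
    let χ : V → ZMod 2 := fun p => if K.Reachable (a j₀) p then 1 else 0
    have h1 : Finsupp.linearCombination (ZMod 2) χ (bdry a b z) =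
        z.sum fun j c => c * (χ (a j) + χ (b j)) := by
      have : Finsupp.linearCombination (ZMod 2) χ ∘ₗ bdry a b =
          Finsupp.linearCombination (ZMod 2) fun j => χ (a j) + χ (b j) := by
        ext1 j
        apply LinearMap.ext_ring
        simp [bdry_single]
      exact LinearMap.congr_fun this z
    rw [hz, map_zero, Finsupp.sum, Finset.sum_eq_single j₀] at h1
    · have h2 : χ (a j₀) = 1 := if_pos (SimpleGraph.Reachable.refl _)
      have h3 : χ (b j₀) = 0 := if_neg hbr
      rw [h2, h3, add_zero, mul_one] at h1
      exact hj₀ h1.symm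
    · intro j hj hjj
      have hK : K.Adj (a j) (b j) := by
        refine SimpleGraph.deleteEdges_adj.2 ⟨hH j (by simpa using hj), ?_⟩
        rw [Set.mem_singleton_iff, hab, hab]
        exact fun h => hjj (Subtype.ext h)
      have : χ (a j) = χ (b j) := by
        have : K.Reachable (a j₀) (a j) ↔ K.Reachable (a j₀) (b j) :=
          ⟨fun h => h.trans hK.reachable, fun h => h.trans hK.symm.reachable⟩
        simp only [χ, this]
      rw [this, CharTwo.add_self_eq_zero, mul_zero]
    · intro h
      exact (h (by simpa using hj₀)).elim
  · simp only [SimpleGraph.IsAcyclic, not_forall, not_not] at hac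
    obtain ⟨v, c, hc⟩ := hac
    have h1 : (g : ℕ∞) ≤ (c.mapLe hHG).length :=
      hg.trans (SimpleGraph.egirth_le_length (hc.mapLe hHG))
    rw [SimpleGraph.Walk.length_map, Nat.cast_le] at h1
    refine h1.trans ?_
    rw [← SimpleGraph.Walk.length_edges, ← List.toFinset_card_of_nodup hc.edges_nodup]
    refine (Finset.card_le_card (t := z.support.image Subtype.val) ?_).trans
      Finset.card_image_le
    intro e he
    have := c.edges_subset_edgeSet (List.mem_toFinset.1 he)
    rw [SimpleGraph.edgeSet_fromEdgeSet] at this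
    simpa using this.1

/-- The number of walks of length two which leave `v` and do not return to it is at most four. -/
def IsLight {V : Type*} [Fintype V] (G : SimpleGraph V) [DecidableRel G.Adj] (v : V) : Prop :=
  ∑ w ∈ G.neighborFinset v, (G.degree w - 1) ≤ 4

theorem exists_isInjColoring_of_isLight {V : Type*} [Fintype V] (G : SimpleGraph V)
    [DecidableRel G.Adj] (U : Finset V) (hU : ∀ v ∈ U, IsLight G v) (c : V → Fin 5)
    (hc : ∀ ⦃u v : V⦄, u ∉ U → v ∉ U → u ≠ v → (∃ w, G.Adj u w ∧ G.Adj v w) → c u ≠ c v) :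
    ∃ c' : V → Fin 5, IsInjColoring G c' := by
  classical
  induction U using Finset.induction_on generalizing c with
  | empty => exact ⟨c, fun u v => hc (Finset.notMem_empty u) (Finset.notMem_empty v)⟩
  | insert x U hx ih =>
    let F : Finset V := (G.neighborFinset x).biUnion fun w => (G.neighborFinset w).erase x
    have hF : F.card ≤ 4 := by
      refine Finset.card_biUnion_le.trans (le_trans (Finset.sum_le_sum fun w hw => ?_)
        (hU x (Finset.mem_insert_self _ _)))
      have : x ∈ G.neighborFinset w := by
        rw [SimpleGraph.mem_neighborFinset] at hw ⊢
        exact hw.symm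
      rw [Finset.card_erase_of_mem this, SimpleGraph.card_neighborFinset_eq_degree]
    obtain ⟨k, hk⟩ : ∃ k, k ∉ F.image c := by
      by_contra! h
      have h1 : (Finset.univ : Finset (Fin 5)) ⊆ F.image c := fun k _ => h k
      have h2 := (Finset.card_le_card h1).trans Finset.card_image_le
      rw [Finset.card_univ, Fintype.card_fin] at h2
      omega
    have hkF (y w : V) (hy : y ≠ x) (hxw : G.Adj x w) (hyw : G.Adj y w) : k ≠ c y := by
      rintro rfl
      refine hk (Finset.mem_image_of_mem c (Finset.mem_biUnion.2 ⟨w, ?_, ?_⟩))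
      · simpa using hxw
      · simpa [hy] using hyw.symm
    refine ih (fun v hv => hU v (Finset.mem_insert_of_mem hv)) (Function.update c x k) ?_
    rintro u v hu hv huv ⟨w, huw, hvw⟩
    by_cases hux : u = x
    · subst hux
      rw [Function.update_self, Function.update_of_ne huv.symm]
      exact hkF v w huv.symm huw hvw
    · rw [Function.update_of_ne hux]
      by_cases hvx : v = x
      · subst hvx
        rw [Function.update_self]
        exact (hkF u w huv hvw huw).symm
      · rw [Function.update_of_ne hvx]
        exact hc (by simp [hux, hu]) (by simp [hvx, hv]) huv ⟨w, huw, hvw⟩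

theorem IsInjColoring.of_deleteEdges {V : Type*} [Fintype V] (G : SimpleGraph V)
    [DecidableRel G.Adj] {x y : V} (hx : IsLight G x) (hy : IsLight G y)
    (c : V → Fin 5) (hc : IsInjColoring (G.deleteEdges {s(x, y)}) c) :
    ∃ c' : V → Fin 5, IsInjColoring G c' := by
  classical
  refine exists_isInjColoring_of_isLight G {x, y} (by simp [hx, hy]) c ?_
  rintro u v hu hv huv ⟨w, huw, hvw⟩
  simp only [Finset.mem_insert, Finset.mem_singleton, not_or] at hu hv
  refine hc huv ⟨w, SimpleGraph.deleteEdges_adj.2 ⟨huw, ?_⟩,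
    SimpleGraph.deleteEdges_adj.2 ⟨hvw, ?_⟩⟩
  · simp [hu.1, hu.2]
  · simp [hv.1, hv.2]

/-- A nonempty graph with maximum degree at most three and average degree less than `8 / 3`
has two adjacent light vertices. -/
theorem exists_adj_isLight {V : Type*} [Fintype V] (G : SimpleGraph V) [DecidableRel G.Adj]
    [DecidableEq V]
    (hdeg : ∀ v, G.degree v ≤ 3)
    (hdens : 3 * G.edgeFinset.card < 4 * {v | 0 < G.degree v}.toFinset.card) :
    ∃ x y, G.Adj x y ∧ IsLight G x ∧ IsLight G y := by
  by_contra! hcon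
  have hlight2 (v) (hv : G.degree v ≤ 2) : IsLight G v := by
    unfold IsLight
    calc _ ≤ ∑ w ∈ G.neighborFinset v, 2 := Finset.sum_le_sum fun w _ => by
          have := hdeg w
          omega
      _ = G.degree v * 2 := by simp
      _ ≤ 4 := by omega
  have hsum (v) : ∑ w ∈ G.neighborFinset v, (3 - G.degree w) +
      ∑ w ∈ G.neighborFinset v, (G.degree w - 1) = 2 * G.degree v := by
    rw [← Finset.sum_add_distrib]
    calc _ = ∑ w ∈ G.neighborFinset v, 2 := Finset.sum_congr rfl fun w hw => by
          have h1 := hdeg w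
          have h2 : 0 < G.degree w := by
            rw [SimpleGraph.degree_pos_iff_exists_adj]
            exact ⟨v, ((SimpleGraph.mem_neighborFinset _ _ _).1 hw).symm⟩
          omega
      _ = _ := by simp [mul_comm]
  have hdef0 (v) (hv : IsLight G v) : ∑ w ∈ G.neighborFinset v, (3 - G.degree w) = 0 := by
    refine Finset.sum_eq_zero fun w hw => ?_
    have hvw := (SimpleGraph.mem_neighborFinset _ _ _).1 hw
    have h1 : ¬ G.degree w ≤ 2 := fun h => hcon v w hvw hv (hlight2 w h)
    omega
  have hdef1 (v) : ∑ w ∈ G.neighborFinset v, (3 - G.degree w) ≤ 1 := by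
    by_cases hv : IsLight G v
    · rw [hdef0 v hv]; omega
    · unfold IsLight at hv
      have := hsum v
      have := hdeg v
      omega
  have hne1 (w) : G.degree w ≠ 1 := by
    intro hw
    obtain ⟨v, hv⟩ := (SimpleGraph.degree_pos_iff_exists_adj G w).1 (by omega)
    have h1 := hdef1 v
    have h2 := Finset.single_le_sum (f := fun w => 3 - G.degree w) (fun _ _ => Nat.zero_le _)
      ((SimpleGraph.mem_neighborFinset _ _ _).2 hv.symm)
    omega
  have hcount : ∑ v, ∑ w ∈ G.neighborFinset v, (3 - G.degree w) =
      ∑ w, G.degree w * (3 - G.degree w) := by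
    simp_rw [SimpleGraph.neighborFinset_eq_filter, Finset.sum_filter]
    rw [Finset.sum_comm]
    refine Finset.sum_congr rfl fun w _ => ?_
    rw [← Finset.sum_filter, Finset.sum_const, smul_eq_mul]
    simp_rw [SimpleGraph.adj_comm G _ w]
    rw [← SimpleGraph.neighborFinset_eq_filter, SimpleGraph.card_neighborFinset_eq_degree]
  have hle : ∑ w, G.degree w * (3 - G.degree w) ≤ ∑ w, if G.degree w = 3 then 1 else 0 := by
    rw [← hcount]
    refine Finset.sum_le_sum fun v _ => ?_
    split_ifs with h
    · exact hdef1 v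
    · have := hdeg v
      rw [hdef0 v (hlight2 v (by omega))]
  have hE := G.sum_degrees_eq_twice_card_edges
  have hn : {v | 0 < G.degree v}.toFinset.card = ∑ v, if 0 < G.degree v then 1 else 0 := by
    rw [← Finset.card_filter]
    congr 1
    ext v
    simp
  have hfin : ∑ v, (if 0 < G.degree v then 1 else 0) * 8 +
      ∑ v, (if G.degree v = 3 then 1 else 0) ≤
      ∑ v, G.degree v * 3 + ∑ v, G.degree v * (3 - G.degree v) := by
    rw [← Finset.sum_add_distrib, ← Finset.sum_add_distrib]
    refine Finset.sum_le_sum fun v _ => ?_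
    have h1 := hdeg v
    have h2 := hne1 v
    generalize G.degree v = d at h1 h2
    interval_cases d <;> simp at h2 ⊢
  rw [← Finset.sum_mul, ← Finset.sum_mul, hE, ← hn] at hfin
  omega

theorem three_mul_card_edges_lt {V : Type*} [Fintype V] [DecidableEq V] (G : SimpleGraph V)
    [DecidableRel G.Adj] (hne : G ≠ ⊥)
    (hgirth : 8 ≤ G.egirth) (a b : G.edgeSet → V) (hab : ∀ j, s(a j, b j) = j.1)
    (hML : IsMacLane (LinearMap.ker (bdry a b))) :
    3 * G.edgeFinset.card < 4 * {v | 0 < G.degree v}.toFinset.card := by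
  set S := {v | 0 < G.degree v}.toFinset with hS
  have hadj (j : G.edgeSet) : G.Adj (a j) (b j) := by
    rw [← SimpleGraph.mem_edgeSet, hab]
    exact j.2
  have hJ : Fintype.card G.edgeSet = G.edgeFinset.card := (Set.toFinset_card _).symm
  have hSpos : 0 < S.card := by
    obtain ⟨u, v, huv⟩ := SimpleGraph.ne_bot_iff_exists_adj.1 hne
    refine Finset.card_pos.2 ⟨u, ?_⟩
    rw [hS, Set.mem_toFinset, Set.mem_ofPred_eq, SimpleGraph.degree_pos_iff_exists_adj]
    exact ⟨v, huv⟩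
  have hrk := LinearMap.finrank_range_add_finrank_ker (bdry a b)
  rw [Module.finrank_finsupp_self, hJ] at hrk
  let B : Finset (V →₀ ZMod 2) := S.image fun v => Finsupp.single v 1
  have hmem (u v) (h : G.Adj u v) :
      Finsupp.single u (1 : ZMod 2) ∈ Submodule.span (ZMod 2) (B : Set (V →₀ ZMod 2)) := by
    refine Submodule.subset_span (Finset.mem_coe.2 (Finset.mem_image_of_mem _ ?_))
    rw [hS, Set.mem_toFinset, Set.mem_ofPred_eq, SimpleGraph.degree_pos_iff_exists_adj]
    exact ⟨v, h⟩
  have hle : LinearMap.range (bdry a b) ≤ Submodule.span (ZMod 2) (B : Set (V →₀ ZMod 2)) := by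
    generalize Submodule.span (ZMod 2) (B : Set (V →₀ ZMod 2)) = T at hmem
    rintro _ ⟨z, rfl⟩
    induction z using Finsupp.induction_linear with
    | zero => rw [map_zero]; exact T.zero_mem
    | add x y hx hy => rw [map_add]; exact T.add_mem hx hy
    | single j c =>
      rw [bdry_single]
      exact T.smul_mem _ (T.add_mem (hmem _ _ (hadj j)) (hmem _ _ (hadj j).symm))
  have hrange : Module.finrank (ZMod 2) (LinearMap.range (bdry a b)) ≤ S.card :=
    (Submodule.finrank_mono hle).trans
      ((finrank_span_finset_le_card B).trans Finset.card_image_le)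
  by_cases hpos : 0 < Module.finrank (ZMod 2) (LinearMap.ker (bdry a b))
  · have := hML.mul_finrank_succ_le 8
      (fun z hz hz0 => le_card_support_of_bdry_eq_zero G 8 hgirth a b hab z hz hz0) hpos
    rw [hJ] at this
    omega
  · omega

theorem GridReach.mono {S T : Set (ℤ × ℤ)} (hST : S ⊆ T) {p q : ℤ × ℤ} (h : GridReach S p q) :
    GridReach T p q := by
  induction h with
  | refl => exact Relation.ReflTransGen.refl
  | tail _ hxy ih => exact ih.tail ⟨hST hxy.1, hST hxy.2.1, hxy.2.2⟩

theorem GridStep.symm {S : Set (ℤ × ℤ)} {p q : ℤ × ℤ} (h : GridStep S p q) : GridStep S q p :=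
  ⟨h.2.1, h.1, h.2.2.imp fun _ => Or.symm⟩

theorem GridReach.symm {S : Set (ℤ × ℤ)} {p q : ℤ × ℤ} (h : GridReach S p q) :
    GridReach S q p := by
  induction h with
  | refl => exact Relation.ReflTransGen.refl
  | tail _ hxy ih => exact Relation.ReflTransGen.head hxy.symm ih

theorem GridReach.mem {S : Set (ℤ × ℤ)} {p q : ℤ × ℤ} (h : GridReach S p q) (hp : p ∈ S) :
    q ∈ S := by
  induction h with
  | refl => exact hp
  | tail _ hxy _ => exact hxy.2.1

/-- A graph drawn in the lattice with thick vertices `B v` and thick edges `L j` is a minor of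
the grid. -/
theorem isMacLane_of_lattice_drawing {V J : Type*} [Finite V] [Finite J] (a b : J → V)
    (hab : ∀ j, a j ≠ b j) (B : V → Set (ℤ × ℤ)) (L : J → Set (ℤ × ℤ)) (base : V → ℤ × ℤ)
    (hBfin : ∀ v, (B v).Finite) (hLfin : ∀ j, (L j).Finite) (hbase : ∀ v, base v ∈ B v)
    (hB : ∀ v, ∀ p ∈ B v, GridReach (B v) p (base v))
    (hBB : ∀ u v p, p ∈ B u → p ∈ B v → u = v)
    (hLL : ∀ i j p, p ∈ L i → p ∈ L j → i = j)
    (hLB : ∀ j v p, p ∈ L j → p ∈ B v → v = a j ∨ v = b j)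
    (hL : ∀ j, ∃ p ∈ B (a j), ∃ q ∈ B (b j), p ∈ L j ∧ GridReach (L j) p q) :
    IsMacLane (LinearMap.ker (bdry a b)) := by
  let N (j : J) : Set (ℤ × ℤ) := (B (a j) ∪ L j) \ B (b j)
  let T (j : J) : Set (ℤ × ℤ) := {p | GridReach (N j) (base (a j)) p}
  have hbN (j) : base (a j) ∈ N j :=
    ⟨Or.inl (hbase _), fun h => hab j (hBB _ _ _ (hbase _) h)⟩
  have hTN (j) : T j ⊆ N j := fun p hp => GridReach.mem hp (hbN j)
  have hBT (j) : B (a j) ⊆ T j := fun p hp => (hB _ p hp).symm.mono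
    (fun q hq => (⟨Or.inl hq, fun h => hab j (hBB _ _ _ hq h)⟩ : q ∈ N j))
  have hTB (j p v) (hp : p ∈ T j) (hv : p ∈ B v) : v = a j := by
    rcases hTN j hp with ⟨h1 | h1, h2⟩
    · exact hBB _ _ _ hv h1
    · refine (hLB _ _ _ h1 hv).resolve_right ?_
      rintro rfl
      exact h2 hv
  have hTconn (j p) (hp : p ∈ T j) : GridReach (T j) (base (a j)) p := by
    have hp' : GridReach (N j) (base (a j)) p := hp
    induction hp' with
    | refl => exact Relation.ReflTransGen.refl
    | @tail x y hx hxy ih =>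
      exact (ih hx).tail ⟨hx, hx.tail hxy, hxy.2.2⟩
  let S (v : V) : Set (ℤ × ℤ) := B v ∪ ⋃ j ∈ {j | a j = v}, T j
  have hTS (j) : T j ⊆ S (a j) := fun p hp =>
    Or.inr (Set.mem_biUnion (show j ∈ {i | a i = a j} from rfl) hp)
  have hS (v p) (hp : p ∈ S v) : p ∈ B v ∨ ∃ j, a j = v ∧ p ∈ T j := by
    rcases hp with h | h
    · exact Or.inl h
    · obtain ⟨j, hj, hp⟩ := Set.mem_iUnion₂.1 h
      exact Or.inr ⟨j, hj, hp⟩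
  have hcross (j) : ∃ e, ∃ x ∈ T j, ∃ y ∈ B (b j), x ∈ L j ∧ y ∈ L j ∧
      ((gridTail e = x ∧ gridHead e = y) ∨ (gridTail e = y ∧ gridHead e = x)) := by
    obtain ⟨p, hp, q, hq, hpL, hpq⟩ := hL j
    by_contra! hcon
    have : q ∈ T j := by
      clear hq
      induction hpq with
      | refl => exact hBT j hp
      | @tail x y _ hxy ih =>
        obtain ⟨hxL, hyL, e, he⟩ := hxy
        have hyB : y ∉ B (b j) := fun hy => by
          have := hcon e x ih y hy hxL hyL
          tauto
        exact Relation.ReflTransGen.tail ih ⟨hTN j ih, ⟨Or.inr hyL, hyB⟩, e, he⟩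
    exact (hTN j this).2 hq
  choose ι x hx y hy hxL hyL hι using hcross
  refine isMacLane_of_gridMinor a b hab S (fun v => ?_) ?_ base ?_ ι ?_ ?_
  · refine (hBfin v).union (Set.Finite.biUnion (Set.toFinite _) fun j _ => ?_)
    exact (((hBfin (a j)).union (hLfin j)).subset Set.sdiff_subset).subset (hTN j)
  · intro u v p hu hv
    rcases hS u p hu with h | ⟨i, rfl, h⟩
    · rcases hS v p hv with h' | ⟨j, rfl, h'⟩
      · exact hBB _ _ _ h h'
      · exact hTB _ _ _ h' h
    · rcases hS v p hv with h' | ⟨j, rfl, h'⟩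
      · exact (hTB _ _ _ h h').symm
      · rcases (hTN i h).1 with h1 | h1
        · exact hTB _ _ _ h' h1
        · rcases (hTN j h').1 with h2 | h2
          · exact (hTB _ _ _ h h2).symm
          · rw [hLL _ _ _ h1 h2]
  · intro v p hp
    rcases hS v p hp with h | ⟨j, rfl, h⟩
    · exact (hB v p h).mono Set.subset_union_left
    · exact ((hTconn j p h).mono (hTS j)).symm
  · intro i j hij
    have hi : gridTail (ι i) ∈ L i := by
      rcases hι i with ⟨h, -⟩ | ⟨h, -⟩
      · exact h ▸ hxL i
      · exact h ▸ hyL i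
    have hj : gridTail (ι j) ∈ L j := by
      rcases hι j with ⟨h, -⟩ | ⟨h, -⟩
      · exact h ▸ hxL j
      · exact h ▸ hyL j
    exact hLL _ _ _ hi (hij ▸ hj)
  · intro j
    rcases hι j with ⟨h1, h2⟩ | ⟨h1, h2⟩
    · exact Or.inl ⟨h1 ▸ hTS j (hx j), h2 ▸ Or.inl (hy j)⟩
    · exact Or.inr ⟨h1 ▸ Or.inl (hy j), h2 ▸ hTS j (hx j)⟩

/-- The lattice points at sup-distance at most `k` from `c`. -/
def gridBox (c : ℤ × ℤ) (k : ℤ) : Set (ℤ × ℤ) := {p | |p.1 - c.1| ≤ k ∧ |p.2 - c.2| ≤ k}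

theorem gridBox_finite (c : ℤ × ℤ) (k : ℤ) : (gridBox c k).Finite := by
  refine ((Set.finite_Icc (c.1 - k) (c.1 + k)).prod
    (Set.finite_Icc (c.2 - k) (c.2 + k))).subset ?_
  rintro p ⟨h1, h2⟩
  rw [abs_le] at h1 h2
  exact ⟨⟨by omega, by omega⟩, ⟨by omega, by omega⟩⟩

theorem gridReach_right {S : Set (ℤ × ℤ)} {i j : ℤ} (h1 : (i, j) ∈ S) (h2 : (i + 1, j) ∈ S) :
    GridReach S (i, j) (i + 1, j) :=
  Relation.ReflTransGen.single ⟨h1, h2, ((i, j), false), Or.inl ⟨rfl, rfl⟩⟩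

theorem gridReach_up {S : Set (ℤ × ℤ)} {i j : ℤ} (h1 : (i, j) ∈ S) (h2 : (i, j + 1) ∈ S) :
    GridReach S (i, j) (i, j + 1) :=
  Relation.ReflTransGen.single ⟨h1, h2, ((i, j), true), Or.inl ⟨rfl, rfl⟩⟩

theorem gridReach_horizontal {S : Set (ℤ × ℤ)} {i i' j : ℤ} (h1 : (i, j) ∈ S)
    (h2 : (i', j) ∈ S) (h : |i - i'| ≤ 1) : GridReach S (i, j) (i', j) := by
  rw [abs_le] at h
  obtain rfl | rfl | rfl : i' = i ∨ i' = i + 1 ∨ i = i' + 1 := by omega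
  · exact Relation.ReflTransGen.refl
  · exact gridReach_right h1 h2
  · exact (gridReach_right h2 h1).symm

theorem gridReach_vertical {S : Set (ℤ × ℤ)} {i j j' : ℤ} (h1 : (i, j) ∈ S)
    (h2 : (i, j') ∈ S) (h : |j - j'| ≤ 1) : GridReach S (i, j) (i, j') := by
  rw [abs_le] at h
  obtain rfl | rfl | rfl : j' = j ∨ j' = j + 1 ∨ j = j' + 1 := by omega
  · exact Relation.ReflTransGen.refl
  · exact gridReach_up h1 h2
  · exact (gridReach_up h2 h1).symm

theorem gridReach_gridBox (c : ℤ × ℤ) (k : ℤ) (p : ℤ × ℤ) (hp : p ∈ gridBox c k) :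
    GridReach (gridBox c k) p c := by
  obtain ⟨i, j⟩ := p
  obtain ⟨x, y⟩ := c
  induction hn : (i - x).natAbs + (j - y).natAbs using Nat.strong_induction_on
    generalizing i j with
  | _ n ih =>
    subst hn
    have hp' := hp
    simp only [gridBox, Set.mem_ofPred_eq, abs_le] at hp'
    have hmem (i' j' : ℤ) (h : |i' - x| ≤ k ∧ |j' - y| ≤ k) : (i', j') ∈ gridBox (x, y) k := h
    simp only [abs_le] at hmem
    rcases lt_trichotomy i x with h | h | h
    · have hq := hmem (i + 1) j (by omega)
      exact (gridReach_horizontal hp hq (by simp)).trans (ih _ (by omega) _ _ hq rfl)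
    · subst h
      rcases lt_trichotomy j y with h | h | h
      · have hq := hmem i (j + 1) (by omega)
        exact (gridReach_vertical hp hq (by simp)).trans (ih _ (by omega) _ _ hq rfl)
      · subst h
        exact Relation.ReflTransGen.refl
      · have hq := hmem i (j - 1) (by omega)
        exact (gridReach_vertical hp hq (by simp)).trans (ih _ (by omega) _ _ hq rfl)
    · have hq := hmem (i - 1) j (by omega)
      exact (gridReach_horizontal hp hq (by simp)).trans (ih _ (by omega) _ _ hq rfl)

/-- The lattice point below and to the left of a point of the plane. -/
noncomputable def cell (x : ℝ × ℝ) : ℤ × ℤ := (⌊x.1⌋, ⌊x.2⌋)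

/-- The lattice points at sup-distance at most two from a point of `m`. -/
def latticeNhd (m : Set (ℝ × ℝ)) : Set (ℤ × ℤ) :=
  {p | ∃ x ∈ m, |(p.1 : ℝ) - x.1| ≤ 2 ∧ |(p.2 : ℝ) - x.2| ≤ 2}

theorem cell_mem_latticeNhd {m : Set (ℝ × ℝ)} {x : ℝ × ℝ} (hx : x ∈ m) :
    cell x ∈ latticeNhd m := by
  refine ⟨x, hx, ?_, ?_⟩ <;> rw [abs_le] <;> dsimp only [cell]
  · constructor <;> linarith [Int.floor_le x.1, Int.lt_floor_add_one x.1]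
  · constructor <;> linarith [Int.floor_le x.2, Int.lt_floor_add_one x.2]

theorem abs_floor_sub_floor_le {x y : ℝ} (h : |x - y| < 1) : |⌊x⌋ - ⌊y⌋| ≤ 1 := by
  rw [abs_lt] at h
  have h1 : ⌊x⌋ < ⌊y⌋ + 2 := by
    rw [Int.floor_lt]
    push_cast
    linarith [Int.lt_floor_add_one y]
  have h2 : ⌊y⌋ < ⌊x⌋ + 2 := by
    rw [Int.floor_lt]
    push_cast
    linarith [Int.lt_floor_add_one x]
  rw [abs_le]
  omega

theorem gridReach_cell {m : Set (ℝ × ℝ)} (hm : IsPreconnected m) {x y : ℝ × ℝ} (hx : x ∈ m)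
    (hy : y ∈ m) : GridReach (latticeNhd m) (cell x) (cell y) := by
  refine hm.induction₂' (fun x y => GridReach (latticeNhd m) (cell x) (cell y)) ?_
    (fun _ _ _ _ _ _ h1 h2 => h1.trans h2) hx hy
  intro x hx
  filter_upwards [self_mem_nhdsWithin, mem_nhdsWithin_of_mem_nhds (Metric.ball_mem_nhds x one_pos)]
    with y hy hyx
  rw [Metric.mem_ball, _root_.dist_comm, Prod.dist_eq, max_lt_iff, Real.dist_eq,
    Real.dist_eq] at hyx
  have hc : (⌊y.1⌋, ⌊x.2⌋) ∈ latticeNhd m := by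
    refine ⟨x, hx, ?_, ?_⟩ <;> rw [abs_le] <;> dsimp only
    · have := abs_lt.1 hyx.1
      constructor <;> linarith [Int.floor_le y.1, Int.lt_floor_add_one y.1]
    · constructor <;> linarith [Int.floor_le x.2, Int.lt_floor_add_one x.2]
  have : GridReach (latticeNhd m) (cell x) (cell y) :=
    (gridReach_horizontal (cell_mem_latticeNhd hx) hc (abs_floor_sub_floor_le hyx.1)).trans
      (gridReach_vertical hc (cell_mem_latticeNhd hy) (abs_floor_sub_floor_le hyx.2))
  exact ⟨this, this.symm⟩

theorem latticeNhd_finite {m : Set (ℝ × ℝ)} (hm : Bornology.IsBounded m) :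
    (latticeNhd m).Finite := by
  obtain ⟨C, hC⟩ := hm.subset_closedBall 0
  refine (gridBox_finite 0 (⌈C⌉ + 2)).subset ?_
  rintro p ⟨x, hx, h1, h2⟩
  have h := hC hx
  rw [Metric.mem_closedBall, Prod.dist_eq, max_le_iff, Real.dist_eq, Real.dist_eq] at h
  simp only [Prod.fst_zero, Prod.snd_zero, sub_zero] at h
  have hC' := Int.le_ceil C
  constructor
  · have : |(p.1 : ℝ)| ≤ C + 2 := by
      calc |(p.1 : ℝ)| = |((p.1 : ℝ) - x.1) + x.1| := by ring_nf
        _ ≤ _ := (abs_add_le _ _).trans (by linarith)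
    simp only [Prod.fst_zero, sub_zero]
    have h' : ((|p.1| : ℤ) : ℝ) ≤ ((⌈C⌉ + 2 : ℤ) : ℝ) := by push_cast; linarith
    exact_mod_cast h'
  · have : |(p.2 : ℝ)| ≤ C + 2 := by
      calc |(p.2 : ℝ)| = |((p.2 : ℝ) - x.2) + x.2| := by ring_nf
        _ ≤ _ := (abs_add_le _ _).trans (by linarith)
    simp only [Prod.snd_zero, sub_zero]
    have h' : ((|p.2| : ℤ) : ℝ) ≤ ((⌈C⌉ + 2 : ℤ) : ℝ) := by push_cast; linarith
    exact_mod_cast h'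

theorem exists_dist_le_of_mem_latticeNhd {m : Set (ℝ × ℝ)} {p : ℤ × ℤ}
    (hp : p ∈ latticeNhd m) : ∃ x ∈ m, dist ((p.1 : ℝ), (p.2 : ℝ)) x ≤ 2 := by
  obtain ⟨x, hx, h1, h2⟩ := hp
  exact ⟨x, hx, by rw [Prod.dist_eq, max_le_iff, Real.dist_eq, Real.dist_eq]; exact ⟨h1, h2⟩⟩

theorem dist_le_of_mem_gridBox {x : ℝ × ℝ} {k : ℤ} {p : ℤ × ℤ}
    (hp : p ∈ gridBox (cell x) k) : dist ((p.1 : ℝ), (p.2 : ℝ)) x ≤ k + 1 := by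
  have key (i : ℤ) (y : ℝ) (h : |i - ⌊y⌋| ≤ k) : |(i : ℝ) - y| ≤ k + 1 := by
    have h' : ((|i - ⌊y⌋| : ℤ) : ℝ) ≤ k := by exact_mod_cast h
    push_cast at h'
    rw [abs_le] at h' ⊢
    constructor <;> linarith [Int.floor_le y, Int.lt_floor_add_one y]
  rw [Prod.dist_eq, max_le_iff, Real.dist_eq, Real.dist_eq]
  exact ⟨key _ _ hp.1, key _ _ hp.2⟩

theorem cell_mem_gridBox {x y : ℝ × ℝ} {R : ℝ} (h : dist x y ≤ R) :
    cell x ∈ gridBox (cell y) (⌈R⌉ + 2) := by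
  have key (s t : ℝ) (h : |s - t| ≤ R) : |⌊s⌋ - ⌊t⌋| ≤ ⌈R⌉ + 2 := by
    have h' : ((|⌊s⌋ - ⌊t⌋| : ℤ) : ℝ) ≤ ((⌈R⌉ + 2 : ℤ) : ℝ) := by
      push_cast
      rw [abs_le] at h ⊢
      constructor <;> linarith [Int.floor_le s, Int.lt_floor_add_one s, Int.floor_le t,
        Int.lt_floor_add_one t, Int.le_ceil R]
    exact_mod_cast h'
  rw [Prod.dist_eq, max_le_iff, Real.dist_eq, Real.dist_eq] at h
  exact ⟨key _ _ h.1, key _ _ h.2⟩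

/-- A plane drawing whose features are large compared to the unit lattice can be discretised. -/
theorem isMacLane_of_coarse_drawing {V J : Type*} [Finite V] [Finite J] (a b : J → V)
    (hab : ∀ j, a j ≠ b j) (f : V → ℝ × ℝ) (m : J → Set (ℝ × ℝ)) (R : ℝ) (hR : 10 ≤ R)
    (hm : ∀ j, IsPreconnected (m j)) (hmb : ∀ j, Bornology.IsBounded (m j))
    (hff : ∀ u v, u ≠ v → 8 * R ≤ dist (f u) (f v))
    (hma : ∀ j, ∃ x ∈ m j, dist x (f (a j)) ≤ R) (hmb' : ∀ j, ∃ x ∈ m j, dist x (f (b j)) ≤ R)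
    (hmm : ∀ i j, i ≠ j → ∀ x ∈ m i, ∀ y ∈ m j, 8 ≤ dist x y)
    (hmf : ∀ j v, v ≠ a j → v ≠ b j → ∀ x ∈ m j, 8 * R ≤ dist x (f v)) :
    IsMacLane (LinearMap.ker (bdry a b)) := by
  have hbox {v : V} {p : ℤ × ℤ} (hp : p ∈ gridBox (cell (f v)) (⌈R⌉ + 2)) :
      dist ((p.1 : ℝ), (p.2 : ℝ)) (f v) ≤ R + 4 := by
    have := dist_le_of_mem_gridBox hp
    push_cast at this
    linarith [Int.ceil_lt_add_one R]
  refine isMacLane_of_lattice_drawing a b hab (fun v => gridBox (cell (f v)) (⌈R⌉ + 2))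
    (fun j => latticeNhd (m j)) (fun v => cell (f v)) (fun _ => gridBox_finite _ _)
    (fun j => latticeNhd_finite (hmb j)) (fun v => ?_) (fun _ => gridReach_gridBox _ _) ?_ ?_ ?_ ?_
  · exact cell_mem_gridBox ((dist_self _).le.trans (by linarith))
  · intro u v p hu hv
    by_contra huv
    have := dist_triangle_left (f u) (f v) ((p.1 : ℝ), (p.2 : ℝ))
    linarith [hff u v huv, hbox hu, hbox hv]
  · intro i j p hi hj
    by_contra hij
    obtain ⟨x, hx, hpx⟩ := exists_dist_le_of_mem_latticeNhd hi
    obtain ⟨y, hy, hpy⟩ := exists_dist_le_of_mem_latticeNhd hj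
    have := dist_triangle_left x y ((p.1 : ℝ), (p.2 : ℝ))
    linarith [hmm i j hij x hx y hy]
  · intro j v p hj hv
    by_contra! h
    obtain ⟨x, hx, hpx⟩ := exists_dist_le_of_mem_latticeNhd hj
    have := dist_triangle_left x (f v) ((p.1 : ℝ), (p.2 : ℝ))
    linarith [hmf j v h.1 h.2 x hx, hbox hv]
  · intro j
    obtain ⟨x, hx, hxa⟩ := hma j
    obtain ⟨y, hy, hyb⟩ := hmb' j
    exact ⟨cell x, cell_mem_gridBox hxa, cell y, cell_mem_gridBox hyb, cell_mem_latticeNhd hx,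
      gridReach_cell (hm j) hx hy⟩

theorem isMacLane_of_separated_drawing {V J : Type*} [Finite V] [Finite J] (a b : J → V)
    (hab : ∀ j, a j ≠ b j) (f : V → ℝ × ℝ) (m : J → Set (ℝ × ℝ)) (r η : ℝ) (hr : 0 < r)
    (hη : 0 < η) (hm : ∀ j, IsPreconnected (m j)) (hmc : ∀ j, IsCompact (m j))
    (hff : ∀ u v, u ≠ v → 8 * r ≤ dist (f u) (f v))
    (hma : ∀ j, ∃ x ∈ m j, dist x (f (a j)) ≤ r) (hmb : ∀ j, ∃ x ∈ m j, dist x (f (b j)) ≤ r)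
    (hmm : ∀ i j, i ≠ j → ∀ x ∈ m i, ∀ y ∈ m j, η ≤ dist x y)
    (hmf : ∀ j v, v ≠ a j → v ≠ b j → ∀ x ∈ m j, 8 * r ≤ dist x (f v)) :
    IsMacLane (LinearMap.ker (bdry a b)) := by
  obtain ⟨c, hc, hcr, hcη⟩ : ∃ c : ℝ, 0 < c ∧ 10 ≤ c * r ∧ 8 ≤ c * η := by
    refine ⟨10 / r + 8 / η, by positivity, ?_, ?_⟩
    · rw [add_mul, div_mul_cancel₀ _ hr.ne']
      exact le_add_of_nonneg_right (by positivity)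
    · rw [add_mul, div_mul_cancel₀ _ hη.ne']
      exact le_add_of_nonneg_left (by positivity)
  have hd (x y : ℝ × ℝ) : dist (c • x) (c • y) = c * dist x y := by
    rw [dist_smul₀, Real.norm_of_nonneg hc.le]
  have hcont : Continuous fun x : ℝ × ℝ => c • x := continuous_const_smul c
  refine isMacLane_of_coarse_drawing a b hab (fun v => c • f v) (fun j => (c • ·) '' m j) (c * r)
    hcr (fun j => (hm j).image _ hcont.continuousOn)
    (fun j => ((hmc j).image hcont).isBounded) ?_ ?_ ?_ ?_ ?_
  · intro u v huv
    rw [hd]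
    nlinarith [hff u v huv]
  · intro j
    obtain ⟨x, hx, h⟩ := hma j
    exact ⟨_, ⟨x, hx, rfl⟩, by rw [hd]; gcongr⟩
  · intro j
    obtain ⟨x, hx, h⟩ := hmb j
    exact ⟨_, ⟨x, hx, rfl⟩, by rw [hd]; gcongr⟩
  · rintro i j hij _ ⟨x, hx, rfl⟩ _ ⟨y, hy, rfl⟩
    dsimp only
    rw [hd]
    exact hcη.trans (by gcongr; exact hmm i j hij x hx y hy)
  · rintro j v hva hvb _ ⟨x, hx, rfl⟩
    dsimp only
    rw [hd]
    nlinarith [hmf j v hva hvb x hx]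

theorem eventually_mul_le_nhdsGT_zero (k : ℝ) {d : ℝ} (hd : 0 < d) :
    ∀ᶠ r in nhdsWithin (0 : ℝ) (Set.Ioi 0), k * r ≤ d := by
  have : Filter.Tendsto (fun r : ℝ => k * r) (nhds 0) (nhds (k * 0)) :=
    (continuous_const.mul continuous_id).tendsto 0
  rw [mul_zero] at this
  exact ((this.eventually (gt_mem_nhds hd)).mono fun _ h => h.le).filter_mono nhdsWithin_le_nhds

theorem exists_pos_le_dist {X : Type*} [MetricSpace X] {s t : Set X} (hs : IsCompact s)
    (ht : IsCompact t) (hst : Disjoint s t) : ∃ d > 0, ∀ x ∈ s, ∀ y ∈ t, d ≤ dist x y := by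
  obtain ⟨δ, hδ, h⟩ := hst.exists_thickenings hs ht.isClosed
  refine ⟨δ, hδ, fun x hx y hy => ?_⟩
  by_contra! hlt
  refine Set.disjoint_left.1 h (Metric.self_subset_thickening hδ _ hx) ?_
  exact Metric.mem_thickening_iff.2 ⟨y, hy, hlt⟩

theorem isMacLane_of_arcs {V J : Type*} [Finite V] [Finite J] (a b : J → V)
    (hab : ∀ j, a j ≠ b j) (f : V → ℝ × ℝ) (hf : Function.Injective f) (g : J → ℝ → ℝ × ℝ)
    (hg : ∀ j, Continuous (g j)) (h0 : ∀ j, g j 0 = f (a j)) (h1 : ∀ j, g j 1 = f (b j))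
    (hgf : ∀ j, ∀ t ∈ Set.Icc (0 : ℝ) 1, ∀ v, g j t = f v → v = a j ∨ v = b j)
    (hgg : ∀ i j, i ≠ j → ∀ s ∈ Set.Ioo (0 : ℝ) 1, ∀ t ∈ Set.Ioo (0 : ℝ) 1, g i s ≠ g j t) :
    IsMacLane (LinearMap.ker (bdry a b)) := by
  obtain ⟨r, hr, hff, hgf'⟩ : ∃ r : ℝ, 0 < r ∧ (∀ u v, u ≠ v → 8 * r ≤ dist (f u) (f v)) ∧
      ∀ j v, v ≠ a j → v ≠ b j → ∀ t ∈ Set.Icc (0 : ℝ) 1, 8 * r ≤ dist (g j t) (f v) := by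
    have e1 : ∀ᶠ r in nhdsWithin (0 : ℝ) (Set.Ioi 0),
        ∀ u v, u ≠ v → 8 * r ≤ dist (f u) (f v) := by
      simp only [Filter.eventually_all]
      exact fun u v huv => eventually_mul_le_nhdsGT_zero 8 (dist_pos.2 (hf.ne huv))
    have e2 : ∀ᶠ r in nhdsWithin (0 : ℝ) (Set.Ioi 0),
        ∀ j v, v ≠ a j → v ≠ b j → ∀ t ∈ Set.Icc (0 : ℝ) 1, 8 * r ≤ dist (g j t) (f v) := by
      simp only [Filter.eventually_all]
      intro j v hva hvb
      obtain ⟨d, hd, h⟩ := exists_pos_le_dist (isCompact_Icc.image (hg j))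
        (isCompact_singleton (x := f v)) (Set.disjoint_singleton_right.2 (by
          rintro ⟨t, ht, h⟩
          exact (hgf j t ht v h).elim hva hvb))
      filter_upwards [eventually_mul_le_nhdsGT_zero 8 hd] with r hr t ht
      exact hr.trans (h _ ⟨t, ht, rfl⟩ _ rfl)
    obtain ⟨r, ⟨h1, h2⟩, h3⟩ := ((e1.and e2).and self_mem_nhdsWithin).exists
    exact ⟨r, h3, h1, h2⟩
  obtain ⟨ε, hε, hε', hga, hgb⟩ : ∃ ε : ℝ, 0 < ε ∧ 2 * ε ≤ 1 ∧
      (∀ j, dist (g j ε) (f (a j)) ≤ r) ∧ ∀ j, dist (g j (1 - ε)) (f (b j)) ≤ r := by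
    have e1 : ∀ᶠ ε in nhdsWithin (0 : ℝ) (Set.Ioi 0), ∀ j, dist (g j ε) (f (a j)) ≤ r := by
      refine Filter.eventually_all.2 fun j => Filter.Eventually.filter_mono nhdsWithin_le_nhds ?_
      have := ((hg j).tendsto 0).eventually (Metric.closedBall_mem_nhds _ hr)
      simpa [h0] using this
    have e2 : ∀ᶠ ε in nhdsWithin (0 : ℝ) (Set.Ioi 0), ∀ j, dist (g j (1 - ε)) (f (b j)) ≤ r := by
      refine Filter.eventually_all.2 fun j => Filter.Eventually.filter_mono nhdsWithin_le_nhds ?_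
      have hc : Continuous fun ε => g j (1 - ε) := (hg j).comp (continuous_const.sub continuous_id)
      have := (hc.tendsto 0).eventually (Metric.closedBall_mem_nhds _ hr)
      simpa [h1] using this
    obtain ⟨ε, ⟨⟨h1, h2⟩, h3⟩, h4⟩ := (((e1.and e2).and
      (eventually_mul_le_nhdsGT_zero 2 one_pos)).and self_mem_nhdsWithin).exists
    exact ⟨ε, h4, h3, h1, h2⟩
  have hsub : Set.Icc ε (1 - ε) ⊆ Set.Ioo (0 : ℝ) 1 := fun t ht =>
    ⟨hε.trans_le ht.1, ht.2.trans_lt (by linarith)⟩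
  have hcomp (j) : IsCompact (g j '' Set.Icc ε (1 - ε)) := isCompact_Icc.image (hg j)
  obtain ⟨η, hη, hmm⟩ : ∃ η : ℝ, 0 < η ∧ ∀ i j, i ≠ j → ∀ x ∈ g i '' Set.Icc ε (1 - ε),
      ∀ y ∈ g j '' Set.Icc ε (1 - ε), η ≤ dist x y := by
    have e : ∀ᶠ η in nhdsWithin (0 : ℝ) (Set.Ioi 0), ∀ i j, i ≠ j →
        ∀ x ∈ g i '' Set.Icc ε (1 - ε), ∀ y ∈ g j '' Set.Icc ε (1 - ε), η ≤ dist x y := by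
      simp only [Filter.eventually_all]
      intro i j hij
      obtain ⟨d, hd, h⟩ := exists_pos_le_dist (hcomp i) (hcomp j) (Set.disjoint_left.2 (by
        rintro _ ⟨s, hs, rfl⟩ ⟨t, ht, h⟩
        exact hgg i j hij s (hsub hs) t (hsub ht) h.symm))
      filter_upwards [eventually_mul_le_nhdsGT_zero 1 hd] with η hη x hx y hy
      exact (one_mul η).ge.trans (hη.trans (h x hx y hy))
    obtain ⟨η, h1, h2⟩ := (e.and self_mem_nhdsWithin).exists
    exact ⟨η, h2, h1⟩
  refine isMacLane_of_separated_drawing a b hab f (fun j => g j '' Set.Icc ε (1 - ε)) r η hr hη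
    (fun j => isPreconnected_Icc.image _ (hg j).continuousOn) hcomp hff
    (fun j => ⟨_, ⟨ε, ⟨le_rfl, by linarith⟩, rfl⟩, hga j⟩)
    (fun j => ⟨_, ⟨1 - ε, ⟨by linarith, le_rfl⟩, rfl⟩, hgb j⟩) hmm ?_
  rintro j v hva hvb _ ⟨t, ht, rfl⟩
  exact hgf' j v hva hvb t (Set.Ioo_subset_Icc_self (hsub ht))

theorem IsPlanar.isMacLane {V : Type*} [Finite V] {G : SimpleGraph V} (hG : IsPlanar G)
    (a b : G.edgeSet → V) (hab : ∀ j, s(a j, b j) = j.1) :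
    IsMacLane (LinearMap.ker (bdry a b)) := by
  obtain ⟨f, γ, hf, hinj, -, hend, hcross⟩ := hG
  have hadj (j) : G.Adj (a j) (b j) := by
    rw [← mem_edgeSet, hab]
    exact j.2
  have hval (j) {t : ℝ} (ht : t ∈ Set.Icc (0 : ℝ) 1) :
      (γ (hadj j)).extend t = γ (hadj j) ⟨t, ht⟩ := Path.extend_apply _ ht
  refine isMacLane_of_arcs a b (fun j => (hadj j).ne) f hf (fun j => (γ (hadj j)).extend)
    (fun j => (γ (hadj j)).continuous_extend) (fun j => (γ (hadj j)).extend_zero)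
    (fun j => (γ (hadj j)).extend_one) ?_ ?_
  · intro j t ht v h
    exact hend (hadj j) v ⟨⟨t, ht⟩, by rw [← hval, h]⟩
  · intro i j hij s hs t ht h
    have hs' := Set.Ioo_subset_Icc_self hs
    have ht' := Set.Ioo_subset_Icc_self ht
    rw [hval i hs', hval j ht'] at h
    have hne : s(a i, b i) ≠ s(a j, b j) := by
      rw [hab, hab]
      exact fun h => hij (Subtype.ext h)
    have hmem := (hcross (hadj i) (hadj j) hne ⟨⟨⟨s, hs'⟩, rfl⟩, ⟨⟨t, ht'⟩, h.symm⟩⟩).1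
    rcases hmem with h' | h'
    · have := congrArg Subtype.val (hinj _ (h'.trans (γ (hadj i)).source.symm))
      exact hs.1.ne' this
    · have := congrArg Subtype.val
        (hinj _ ((Set.mem_singleton_iff.1 h').trans (γ (hadj i)).target.symm))
      exact hs.2.ne this

theorem IsPlanar.mono {V : Type*} {G H : SimpleGraph V} (hle : H ≤ G) (hG : IsPlanar G) :
    IsPlanar H := by
  obtain ⟨f, γ, hf, hinj, hsymm, hend, hcross⟩ := hG
  exact ⟨f, fun _ _ h => γ (hle h), hf, fun _ _ h => hinj (hle h), fun _ _ h => hsymm (hle h),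
    fun _ _ h => hend (hle h), fun _ _ _ _ h₁ h₂ => hcross (hle h₁) (hle h₂)⟩

theorem IsPlanar.exists_isInjColoring {V : Type*} [Finite V] (G : SimpleGraph V)
    (hG : IsPlanar G) (hgirth : 8 ≤ G.egirth) (hdeg : ∀ v, (G.neighborSet v).ncard ≤ 3) :
    ∃ c : V → Fin 5, IsInjColoring G c := by
  classical
  have := Fintype.ofFinite V
  induction hn : G.edgeSet.ncard using Nat.strong_induction_on generalizing G with
  | _ n ih =>
    subst hn
    have hdeg' (v) : G.degree v ≤ 3 := by
      rw [← card_neighborSet_eq_degree, ← Nat.card_eq_fintype_card]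
      exact hdeg v
    by_cases hne : G = ⊥
    · subst hne
      exact ⟨0, fun u v _ ⟨w, h, _⟩ => h.elim⟩
    · have hor (j : G.edgeSet) : ∃ p : V × V, s(p.1, p.2) = j.1 := by
        obtain ⟨e, he⟩ := j
        induction e with
        | _ x y => exact ⟨(x, y), rfl⟩
      choose p hp using hor
      obtain ⟨x, y, hxy, hx, hy⟩ := exists_adj_isLight G hdeg'
        (three_mul_card_edges_lt G hne hgirth (fun j => (p j).1) (fun j => (p j).2) hp
          (hG.isMacLane _ _ hp))
      have hle : G.deleteEdges {s(x, y)} ≤ G := G.deleteEdges_le _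
      obtain ⟨c, hc⟩ := ih _ (by
        refine Set.ncard_lt_ncard ?_ (Set.toFinite _)
        rw [edgeSet_deleteEdges]
        exact Set.sdiff_ssubset_left_iff.2 ⟨_, hxy, rfl⟩) (G.deleteEdges {s(x, y)}) (hG.mono hle)
        (hgirth.trans (egirth_anti hle))
        (fun v => (Set.ncard_le_ncard (fun _ h => hle h) (Set.toFinite _)).trans (hdeg v)) rfl
      exact IsInjColoring.of_deleteEdges G hx hy c hc

/-- Every planar graph with maximum degree `3` and girth at least `8` has
injective chromatic number at most `5`. -/
theorem injChromNum_le_five_of_planar {V : Type*} [Fintype V]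
    (G : SimpleGraph V) [DecidableRel G.Adj]
    (hplanar : IsPlanar G) (hΔ : G.maxDegree = 3) (hgirth : 8 ≤ G.egirth) :
    injChromNum G ≤ 5 := by
  refine Nat.sInf_le (hplanar.exists_isInjColoring G hgirth fun v => ?_)
  rw [← hΔ, ← Nat.card_coe_set_eq, Nat.card_eq_fintype_card, card_neighborSet_eq_degree]
  exact G.degree_le_maxDegree v
end

section
/- Let G be a finite simple graph with maximum degree Δ = Δ(G), let u be a vertex of degree 3 in G, and let v and w be two distinct neighbors of u each of degree 2. If the graph G − {u, v, w} admits an injective coloring using at most Δ + 2 colors, then G admits an injective coloring using at most Δ + 2 colors. -/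
open SimpleGraph

/-- `c` is an injective coloring of `G` when only conflicts between vertices of `S` count. -/
def IsInjColoringOn {V α : Type*} (G : SimpleGraph V) (S : Set V) (c : V → α) : Prop :=
  ∀ ⦃a b : V⦄, a ∈ S → b ∈ S → a ≠ b → (∃ p, G.Adj a p ∧ G.Adj b p) → c a ≠ c b

/-- A vertex `a` with `∑ b ∈ N(a), (deg b - 1) < k` can be added greedily to the domain of a
partial injective coloring with `k` colors. -/
theorem IsInjColoringOn.exists_insert {V : Type*} [Fintype V] [DecidableEq V]
    {G : SimpleGraph V} [DecidableRel G.Adj] {k : ℕ} {S : Set V} {c : V → Fin k}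
    (hc : IsInjColoringOn G S c) {a : V}
    (ha : ∑ b ∈ G.neighborFinset a, (G.degree b - 1) < k) :
    ∃ c' : V → Fin k, IsInjColoringOn G (insert a S) c' := by
  let N := (G.neighborFinset a).biUnion fun b => (G.neighborFinset b).erase a
  have hN : N.card < k := by
    refine lt_of_le_of_lt (Finset.card_biUnion_le.trans (Finset.sum_le_sum fun b hb => ?_)) ha
    rw [Finset.card_erase_of_mem (by simpa [G.adj_comm] using hb), card_neighborFinset_eq_degree]
  obtain ⟨d, hd⟩ : ∃ d, d ∉ N.image c := by
    by_contra! hall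
    have h := Finset.card_le_card fun x (_ : x ∈ Finset.univ) => hall x
    rw [Finset.card_univ, Fintype.card_fin] at h
    exact absurd (h.trans Finset.card_image_le) (not_le.mpr hN)
  have hne : ∀ b, b ≠ a → (∃ p, G.Adj a p ∧ G.Adj b p) → c b ≠ d := by
    rintro b hb ⟨p, hap, hbp⟩ rfl
    refine hd (Finset.mem_image_of_mem c (Finset.mem_biUnion.mpr ⟨p, by simpa using hap, ?_⟩))
    simpa [hb] using hbp.symm
  refine ⟨Function.update c a d, fun x y hx hy hxy hp => ?_⟩
  by_cases hxa : x = a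
  · subst hxa
    rw [Function.update_self, Function.update_of_ne hxy.symm]
    exact (hne y hxy.symm hp).symm
  · rw [Function.update_of_ne hxa]
    by_cases hya : y = a
    · subst hya
      rw [Function.update_self]
      exact hne x hxa (hp.imp fun _ h => h.symm)
    · rw [Function.update_of_ne hya]
      exact hc (hx.resolve_left hxa) (hy.resolve_left hya) hxy hp

/-- The sum of `deg - 1` over the neighbors of a vertex, bounded by separating a set `T` of
neighbors from the remaining ones. -/
theorem sum_degree_sub_one_le {V : Type*} [Fintype V] [DecidableEq V]
    (G : SimpleGraph V) [DecidableRel G.Adj] {a : V} {T : Finset V}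
    (hT : T ⊆ G.neighborFinset a) :
    ∑ b ∈ G.neighborFinset a, (G.degree b - 1) ≤
      ∑ b ∈ T, (G.degree b - 1) + (G.degree a - T.card) * (G.maxDegree - 1) := by
  rw [← Finset.sum_sdiff hT, add_comm]
  refine Nat.add_le_add_left ?_ _
  rw [← card_neighborFinset_eq_degree, ← Finset.card_sdiff_of_subset hT]
  exact Finset.sum_le_card_nsmul _ _ _ fun b _ => Nat.sub_le_sub_right (G.degree_le_maxDegree b) 1

/-- If all but at most one of the neighbors of `p` lie in `T`, then two neighbors of `p` outside
of `T` coincide. -/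
theorem eq_of_adj_of_notMem {V : Type*} [Fintype V] [DecidableEq V]
    {G : SimpleGraph V} [DecidableRel G.Adj] {p : V} {T : Finset V}
    (hT : T ⊆ G.neighborFinset p) (hcard : G.degree p ≤ T.card + 1) {a b : V}
    (hap : G.Adj a p) (hbp : G.Adj b p) (ha : a ∉ T) (hb : b ∉ T) : a = b := by
  have h : (G.neighborFinset p \ T).card ≤ 1 := by
    rw [Finset.card_sdiff_of_subset hT, card_neighborFinset_eq_degree]
    omega
  exact Finset.card_le_one.mp h a (by simp [ha, hap.symm]) b (by simp [hb, hbp.symm])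

/-- (RC3) If `u` is a `3`-vertex of `G` with two distinct `2`-vertex neighbors `v`
and `w`, and `G - {u, v, w}` has an injective coloring with at most `Δ(G) + 2`
colors, then so does `G`. -/
theorem rc3_three_vertex_two_neighbors {V : Type*} [Fintype V] [DecidableEq V]
    (G : SimpleGraph V) [DecidableRel G.Adj] (u v w : V)
    (hu : G.degree u = 3) (huv : G.Adj u v) (huw : G.Adj u w) (hvw : v ≠ w)
    (hv : G.degree v = 2) (hw : G.degree w = 2)
    (h : ∃ c : ({u, v, w}ᶜ : Set V) → Fin (G.maxDegree + 2),
      IsInjColoring (G.induce ({u, v, w}ᶜ : Set V)) c) :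
    ∃ c : V → Fin (G.maxDegree + 2), IsInjColoring G c := by
  obtain ⟨c, hc⟩ := h
  have hTu : ({v, w} : Finset V) ⊆ G.neighborFinset u := by
    simp [Finset.insert_subset_iff, huv, huw]
  have hTv : ({u} : Finset V) ⊆ G.neighborFinset v := by simpa using huv.symm
  have hTw : ({u} : Finset V) ⊆ G.neighborFinset w := by simpa using huw.symm
  have hΔ : 3 ≤ G.maxDegree := hu ▸ G.degree_le_maxDegree u
  have h₀ : IsInjColoringOn G ({u, v, w}ᶜ : Set V)
      (fun a => if h : a ∈ ({u, v, w}ᶜ : Set V) then c ⟨a, h⟩ else 0) := by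
    rintro a b ha hb hab ⟨p, hap, hbp⟩
    simp only [dif_pos ha, dif_pos hb]
    have ha' : a ≠ u ∧ a ≠ v ∧ a ≠ w := by simpa using ha
    have hb' : b ≠ u ∧ b ≠ v ∧ b ≠ w := by simpa using hb
    have hp : p ∈ ({u, v, w}ᶜ : Set V) := by
      rintro (rfl | rfl | rfl)
      · exact hab (eq_of_adj_of_notMem hTu (by simp [hu, hvw]) hap hbp
          (by simp [ha']) (by simp [hb']))
      · exact hab (eq_of_adj_of_notMem hTv (by simp [hv]) hap hbp (by simp [ha']) (by simp [hb']))
      · exact hab (eq_of_adj_of_notMem hTw (by simp [hw]) hap hbp (by simp [ha']) (by simp [hb']))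
    exact hc (u := ⟨a, ha⟩) (v := ⟨b, hb⟩) (by simpa using hab) ⟨⟨p, hp⟩, hap, hbp⟩
  have hsu := sum_degree_sub_one_le G hTu
  have hsv := sum_degree_sub_one_le G hTv
  have hsw := sum_degree_sub_one_le G hTw
  rw [Finset.sum_pair hvw, Finset.card_pair hvw, hu, hv, hw] at hsu
  rw [Finset.sum_singleton, Finset.card_singleton, hu, hv] at hsv
  rw [Finset.sum_singleton, Finset.card_singleton, hu, hw] at hsw
  obtain ⟨c₁, h₁⟩ := h₀.exists_insert (a := u) (by omega)
  obtain ⟨c₂, h₂⟩ := h₁.exists_insert (a := v) (by omega)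
  obtain ⟨c₃, h₃⟩ := h₂.exists_insert (a := w) (by omega)
  have hmem : ∀ a, a ∈ insert w (insert v (insert u ({u, v, w}ᶜ : Set V))) := by
    intro a
    simp only [Set.mem_insert_iff, Set.mem_compl_iff, Set.mem_singleton_iff]
    tauto
  exact ⟨c₃, fun a b => h₃ (hmem a) (hmem b)⟩
end

section
/- Let G be a finite simple graph with maximum degree Δ(G) ≥ 4 and mad(G) < 14/5. Then G is injectively (Δ(G)+2)-choosable: for every assignment L of lists of colors to the vertices of G with |L(v)| ≥ Δ(G) + 2 for every vertex v, there is an injective coloring of G in which each vertex v receives a color from its list L(v). -/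
open SimpleGraph

namespace InjChoosable

/-- Two distinct vertices are in conflict when they have a common neighbor. -/
def conflictGraph {V : Type*} (G : SimpleGraph V) : SimpleGraph V where
  Adj u v := u ≠ v ∧ ∃ w, G.Adj u w ∧ G.Adj v w
  symm := ⟨fun _ _ ⟨h, w, hu, hv⟩ => ⟨h.symm, w, hv, hu⟩⟩
  loopless := ⟨fun _ h => h.1 rfl⟩

theorem deleteEdge_lt {V : Type*} {G : SimpleGraph V} {x y : V} (hxy : G.Adj x y) :
    G.deleteEdges {s(x, y)} < G := by
  refine lt_of_le_of_ne (deleteEdges_le _) fun h => ?_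
  rw [← h] at hxy
  simp at hxy

section Incidence

variable {α β : Type*} [DecidableEq α] [DecidableEq β]

omit [DecidableEq α] in
/-- A vertex-minimal set `W` spanning at least `#W` edges of a simple graph (with edge set `E` and
endpoint map `N`) spans a `2`-regular graph. -/
theorem exists_minimal_dense (E : Finset α) (N : α → Finset β) (hN : ∀ u ∈ E, (N u).card = 2)
    (hinj : ∀ u ∈ E, ∀ v ∈ E, N u = N v → u = v) (W : Finset β) (hW : W.Nonempty)
    (hd : W.card ≤ (E.filter (N · ⊆ W)).card) :
    ∃ W : Finset β, W.Nonempty ∧ W.card ≤ (E.filter (N · ⊆ W)).card ∧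
      (∀ x ∈ W, ((E.filter (N · ⊆ W)).filter (x ∈ N ·)).card = 2) ∧
      ∀ W' ⊂ W, W'.Nonempty → (E.filter (N · ⊆ W')).card < W'.card := by
  induction W using Finset.strongInduction with
  | H W ih =>
    by_cases hmin : ∃ W' ⊂ W, W'.Nonempty ∧ W'.card ≤ (E.filter (N · ⊆ W')).card
    · obtain ⟨W', h1, h2, h3⟩ := hmin
      exact ih W' h1 h2 h3
    push Not at hmin
    refine ⟨W, hW, hd, ?_, hmin⟩
    set U := E.filter (N · ⊆ W) with hU
    have hU2 : ∀ u ∈ U, (N u).card = 2 := fun u hu => hN u (Finset.mem_filter.1 hu).1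
    have hUW : ∀ u ∈ U, N u ⊆ W := fun u hu => (Finset.mem_filter.1 hu).2
    have hUne : U.Nonempty := Finset.card_pos.1 (hW.card_pos.trans_le hd)
    obtain ⟨u₀, hu₀⟩ := hUne
    have hW2 : 2 ≤ W.card := (hU2 u₀ hu₀) ▸ Finset.card_le_card (hUW u₀ hu₀)
    have hW3 : 3 ≤ W.card := by
      by_contra hlt
      have hall : ∀ u ∈ U, N u = W := fun u hu =>
        Finset.eq_of_subset_of_card_le (hUW u hu) (by rw [hU2 u hu]; omega)
      have : U.card ≤ 1 := Finset.card_le_one.2 fun u hu v hv =>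
        hinj u (Finset.mem_filter.1 hu).1 v (Finset.mem_filter.1 hv).1
          ((hall u hu).trans (hall v hv).symm)
      omega
    have hdeg : ∀ x ∈ W, U.card + 2 ≤ (U.filter (x ∈ N ·)).card + W.card := by
      intro x hx
      have hcard := Finset.card_erase_of_mem hx
      have h1 := hmin (W.erase x) (Finset.erase_ssubset hx) (Finset.card_pos.1 (by omega))
      have h2 : E.filter (N · ⊆ W.erase x) = U.filter (x ∉ N ·) := by
        ext u
        simp only [hU, Finset.mem_filter, Finset.subset_erase, and_assoc]
      have h3 := Finset.card_filter_add_card_filter_not (s := U) (x ∈ N ·)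
      rw [h2] at h1
      omega
    have hsum : ∑ x ∈ W, (U.filter (x ∈ N ·)).card = U.card * 2 := by
      have h1 := Finset.sum_card_bipartiteAbove_eq_sum_card_bipartiteBelow
        (s := W) (t := U) (fun x u => x ∈ N u)
      simp only [Finset.bipartiteAbove, Finset.bipartiteBelow] at h1
      rw [h1, Finset.sum_const_nat fun u hu => ?_]
      rw [Finset.filter_mem_eq_inter, Finset.inter_eq_right.2 (hUW u hu), hU2 u hu]
    have hle : U.card ≤ W.card := by
      have h1 := Finset.sum_le_sum hdeg
      simp only [Finset.sum_add_distrib, hsum, Finset.sum_const, smul_eq_mul] at h1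
      nlinarith
    have hge : ∀ x ∈ W, 2 ≤ (U.filter (x ∈ N ·)).card := fun x hx => by
      have := hdeg x hx
      omega
    have heq := (Finset.sum_eq_sum_iff_of_le hge).1 (by
      rw [hsum, Finset.sum_const, smul_eq_mul]
      congr 1
      omega)
    exact fun x hx => (heq x hx).symm

/-- In a minimal `2`-regular graph, deleting an edge `u₁` leaves a path starting with `u₂`. -/
theorem exists_adjacent_outside (E : Finset α) (N : α → Finset β)
    (hN : ∀ u ∈ E, (N u).card = 2) (W : Finset β)
    (hreg : ∀ x ∈ W, ((E.filter (N · ⊆ W)).filter (x ∈ N ·)).card = 2)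
    (hmin : ∀ W' ⊂ W, W'.Nonempty → (E.filter (N · ⊆ W')).card < W'.card)
    {y : β} (hy : y ∈ W) {u₁ u₂ : α}
    (hyU : (E.filter (N · ⊆ W)).filter (y ∈ N ·) = {u₁, u₂}) {T : Finset α}
    (hT : T ⊆ E.filter (N · ⊆ W)) (hTne : T.Nonempty) (h₁ : u₁ ∉ T) (h₂ : u₂ ∉ T) :
    ∃ t ∈ T, ∃ t' ∈ E.filter (N · ⊆ W), t' ≠ u₁ ∧ t' ∉ T ∧ ∃ x, x ∈ N t ∧ x ∈ N t' := by
  by_contra! hcon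
  set U := E.filter (N · ⊆ W) with hU
  have hyu₁ : u₁ ∈ U ∧ y ∈ N u₁ := Finset.mem_filter.1 (hyU ▸ Finset.mem_insert_self u₁ {u₂})
  have hu₁E : u₁ ∈ E := (Finset.mem_filter.1 hyu₁.1).1
  have hUW : ∀ u ∈ U, N u ⊆ W := fun u hu => (Finset.mem_filter.1 hu).2
  have hyT : y ∉ T.biUnion N := by
    intro h
    obtain ⟨t, ht, hyt⟩ := Finset.mem_biUnion.1 h
    have : t ∈ ({u₁, u₂} : Finset α) := hyU ▸ Finset.mem_filter.2 ⟨hT ht, hyt⟩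
    rcases Finset.mem_insert.1 this with rfl | h
    · exact h₁ ht
    · exact h₂ (Finset.mem_singleton.1 h ▸ ht)
  have hsub : T.biUnion N ⊆ W := Finset.biUnion_subset.2 fun t ht => hUW t (hT ht)
  have hne : (T.biUnion N).Nonempty := by
    obtain ⟨t, ht⟩ := hTne
    have : (N t).Nonempty := Finset.card_pos.1 (by
      rw [hN t (Finset.mem_filter.1 (hT ht)).1]; norm_num)
    exact this.mono (Finset.subset_biUnion_of_mem N ht)
  have hlt := hmin _ (Finset.ssubset_iff_subset_ne.2 ⟨hsub, fun h => hyT (h ▸ hy)⟩) hne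
  have hle : T.card ≤ (E.filter (N · ⊆ T.biUnion N)).card := Finset.card_le_card fun t ht =>
    Finset.mem_filter.2 ⟨(Finset.mem_filter.1 (hT ht)).1, Finset.subset_biUnion_of_mem N ht⟩
  have hdeg : ∀ x ∈ T.biUnion N, 2 ≤ (T.filter (x ∈ N ·)).card + if x ∈ N u₁ then 1 else 0 := by
    intro x hx
    rw [← hreg x (hsub hx)]
    have : U.filter (x ∈ N ·) ⊆ T.filter (x ∈ N ·) ∪ ({u₁} : Finset α).filter (x ∈ N ·) := by
      intro t' ht'
      obtain ⟨ht', hxt'⟩ := Finset.mem_filter.1 ht'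
      obtain ⟨t, ht, hxt⟩ := Finset.mem_biUnion.1 hx
      simp only [Finset.mem_union, Finset.mem_filter, Finset.mem_singleton]
      by_cases h : t' = u₁
      · exact Or.inr ⟨h, hxt'⟩
      · by_contra hn
        exact hcon t ht t' ht' h (fun h' => hn (Or.inl ⟨h', hxt'⟩)) x hxt hxt'
    refine (Finset.card_le_card this).trans ((Finset.card_union_le _ _).trans ?_)
    rw [Finset.filter_singleton]
    split_ifs <;> simp
  have hsum : ∑ x ∈ T.biUnion N, (T.filter (x ∈ N ·)).card = T.card * 2 := by
    have h1 := Finset.sum_card_bipartiteAbove_eq_sum_card_bipartiteBelow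
      (s := T.biUnion N) (t := T) (fun x u => x ∈ N u)
    simp only [Finset.bipartiteAbove, Finset.bipartiteBelow] at h1
    rw [h1, Finset.sum_const_nat fun u hu => ?_]
    rw [Finset.filter_mem_eq_inter, Finset.inter_eq_right.2 (Finset.subset_biUnion_of_mem N hu),
      hN u (Finset.mem_filter.1 (hT hu)).1]
  have hone : ∑ x ∈ T.biUnion N, (if x ∈ N u₁ then 1 else 0) ≤ 1 := by
    rw [← Finset.card_filter, Finset.filter_mem_eq_inter]
    have : T.biUnion N ∩ N u₁ ⊆ (N u₁).erase y := fun x hx => by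
      obtain ⟨hx, hx'⟩ := Finset.mem_inter.1 hx
      exact Finset.mem_erase.2 ⟨fun h => hyT (h ▸ hx), hx'⟩
    refine (Finset.card_le_card this).trans ?_
    rw [Finset.card_erase_of_mem hyu₁.2, hN u₁ hu₁E]
  have := Finset.sum_le_sum hdeg
  rw [Finset.sum_add_distrib, hsum, Finset.sum_const, smul_eq_mul] at this
  omega

end Incidence

section

variable {V : Type*} [Fintype V] [DecidableEq V]

instance (G : SimpleGraph V) [DecidableRel G.Adj] : DecidableRel (conflictGraph G).Adj :=
  fun u v => inferInstanceAs (Decidable (u ≠ v ∧ ∃ w, G.Adj u w ∧ G.Adj v w))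

/-- `c` chooses colors from the lists `L` on `P` and is proper for `Q` on `P`. -/
def ListColors (Q : SimpleGraph V) (L : V → Finset ℕ) (P : Finset V) (c : V → ℕ) : Prop :=
  (∀ v ∈ P, c v ∈ L v) ∧ ∀ u ∈ P, ∀ v ∈ P, Q.Adj u v → c u ≠ c v

omit [Fintype V] in
theorem ListColors.update {Q : SimpleGraph V} {L : V → Finset ℕ} {P : Finset V} {c : V → ℕ}
    (hc : ListColors Q L P c) {t : V} (ht : t ∉ P) {x : ℕ} (hx : x ∈ L t)
    (hne : ∀ u ∈ P, Q.Adj t u → c u ≠ x) :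
    ListColors Q L (insert t P) (Function.update c t x) := by
  have hP : ∀ v ∈ P, v ≠ t := fun v hv h => ht (h ▸ hv)
  refine ⟨fun v hv => ?_, fun u hu v hv huv => ?_⟩
  · rcases Finset.mem_insert.1 hv with rfl | hv
    · simpa using hx
    · rw [Function.update_of_ne (hP v hv)]
      exact hc.1 v hv
  · rcases Finset.mem_insert.1 hu with rfl | hu' <;> rcases Finset.mem_insert.1 hv with rfl | hv'
    · exact absurd huv (Q.irrefl)
    · rw [Function.update_self, Function.update_of_ne (hP v hv')]
      exact (hne v hv' huv).symm
    · rw [Function.update_self, Function.update_of_ne (hP u hu')]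
      exact hne u hu' huv.symm
    · rw [Function.update_of_ne (hP u hu'), Function.update_of_ne (hP v hv')]
      exact hc.2 u hu' v hv' huv

/-- Greedy extension of a list coloring from `P` to `P ∪ X`. -/
theorem ListColors.extend (Q : SimpleGraph V) [DecidableRel Q.Adj] (L : V → Finset ℕ)
    (P : Finset V) {c : V → ℕ} (hc : ListColors Q L P c) (X : Finset V) (hPX : Disjoint P X)
    (h : ∀ T ⊆ X, T.Nonempty → ∃ t ∈ T, (Q.neighborFinset t ∩ T).card <
      (L t \ (Q.neighborFinset t ∩ P).image c).card) :
    ∃ c', (∀ v ∈ P, c' v = c v) ∧ ListColors Q L (P ∪ X) c' := by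
  induction hn : X.card generalizing X with
  | zero =>
    rw [Finset.card_eq_zero] at hn
    subst hn
    exact ⟨c, fun _ _ => rfl, by simpa using hc⟩
  | succ n ih =>
    obtain ⟨t, htX, ht⟩ := h X subset_rfl (Finset.card_pos.1 (by omega))
    obtain ⟨c', hcc', hc'⟩ := ih (X.erase t) (hPX.mono_right (Finset.erase_subset _ _))
      (fun T hT => h T (hT.trans (Finset.erase_subset _ _)))
      (by rw [Finset.card_erase_of_mem htX]; omega)
    have hlt : ((Q.neighborFinset t ∩ X).image c').card <
        (L t \ (Q.neighborFinset t ∩ P).image c).card := Finset.card_image_le.trans_lt ht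
    obtain ⟨x, hx, hx'⟩ := Finset.exists_mem_notMem_of_card_lt_card hlt
    have htP : t ∉ P := fun h => Finset.disjoint_left.1 hPX h htX
    have hx := Finset.mem_sdiff.1 hx
    have := hc'.update (t := t) (x := x) (by simp [htP]) hx.1 (fun u hu hadj hux => by
      rcases Finset.mem_union.1 hu with hu | hu
      · exact hx.2 (Finset.mem_image.2 ⟨u, by simp [hadj, hu], by rw [← hcc' u hu, hux]⟩)
      · exact hx' (Finset.mem_image.2 ⟨u, by simp [hadj, Finset.mem_of_mem_erase hu], hux⟩))
    refine ⟨Function.update c' t x, fun v hv => ?_, ?_⟩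
    · rw [Function.update_of_ne (by rintro rfl; exact htP hv)]
      exact hcc' v hv
    · rwa [← Finset.union_insert, Finset.insert_erase htX] at this

omit [Fintype V] in
theorem card_sdiff_image_add_le (A N : Finset V) (s : Finset ℕ) (c : V → ℕ) {k : ℕ}
    (hs : k ≤ s.card) (hA : (N ∩ A).card ≤ k) : k - (N ∩ A).card ≤ (s \ (N ∩ A).image c).card := by
  have h1 := Finset.le_card_sdiff ((N ∩ A).image c) s
  have h2 : ((N ∩ A).image c).card ≤ (N ∩ A).card := Finset.card_image_le
  omega

/-- The `k`-core: the largest set all of whose vertices have `k` neighbors inside it. -/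
theorem exists_core (Q : SimpleGraph V) [DecidableRel Q.Adj] (k : ℕ) :
    ∃ K : Finset V, (∀ v ∈ K, k ≤ (Q.neighborFinset v ∩ K).card) ∧
      ∀ T : Finset V, ¬ T ⊆ K → ∃ t ∈ T, t ∉ K ∧ (Q.neighborFinset t ∩ (T ∪ K)).card < k := by
  classical
  let K : Finset V := Finset.univ.filter fun v =>
    ∃ S : Finset V, v ∈ S ∧ ∀ u ∈ S, k ≤ (Q.neighborFinset u ∩ S).card
  have hmax : ∀ S : Finset V, (∀ u ∈ S, k ≤ (Q.neighborFinset u ∩ S).card) → S ⊆ K :=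
    fun S hS v hv => Finset.mem_filter.2 ⟨Finset.mem_univ _, S, hv, hS⟩
  have hK : ∀ v ∈ K, k ≤ (Q.neighborFinset v ∩ K).card := by
    intro v hv
    obtain ⟨S, hvS, hS⟩ := (Finset.mem_filter.1 hv).2
    exact (hS v hvS).trans (Finset.card_le_card (Finset.inter_subset_inter_left (hmax S hS)))
  refine ⟨K, hK, fun T hT => ?_⟩
  by_contra! hcon
  refine hT (Finset.union_subset_left (hmax (T ∪ K) fun u hu => ?_) : T ⊆ K)
  by_cases huK : u ∈ K
  · exact (hK u huK).trans
      (Finset.card_le_card (Finset.inter_subset_inter_left Finset.subset_union_right))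
  · exact hcon u ((Finset.mem_union.1 hu).resolve_right huK) huK

/-- A coloring of the core extends to all vertices. -/
theorem ListColors.extend_core {Q : SimpleGraph V} [DecidableRel Q.Adj] {L : V → Finset ℕ}
    {k : ℕ} (hL : ∀ v, k ≤ (L v).card) {K : Finset V}
    (hK : ∀ T : Finset V, ¬ T ⊆ K →
      ∃ t ∈ T, t ∉ K ∧ (Q.neighborFinset t ∩ (T ∪ K)).card < k)
    {c : V → ℕ} (hc : ListColors Q L K c) : ∃ c', ListColors Q L Finset.univ c' := by
  obtain ⟨c', -, hc'⟩ := hc.extend Q L K Kᶜ disjoint_compl_right fun T hT hne => by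
    have hTK : Disjoint T K := Finset.disjoint_left.2 fun x hx => Finset.mem_compl.1 (hT hx)
    obtain ⟨t, ht, -, hlt⟩ := hK T fun h => hne.ne_empty
      (Finset.disjoint_self_iff_empty T |>.1 (hTK.mono_right h))
    refine ⟨t, ht, ?_⟩
    rw [Finset.inter_union_distrib_left, Finset.card_union_of_disjoint
      (hTK.mono Finset.inter_subset_right Finset.inter_subset_right)] at hlt
    have := card_sdiff_image_add_le K (Q.neighborFinset t) (L t) c (hL t) (by omega)
    omega
  exact ⟨c', by simpa using hc'⟩

/-- Extension of a coloring over `insert w U`: after giving `u₁` a color that is harmless for `w`,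
the rest is colored greedily towards `w`. -/
theorem ListColors.extend_flexible {Q : SimpleGraph V} [DecidableRel Q.Adj] {L : V → Finset ℕ}
    {k : ℕ} (hL : ∀ v, k ≤ (L v).card) {K U : Finset V} {w u₁ : V} (hUK : U ⊆ K) (hwK : w ∈ K)
    (hwU : w ∉ U) (hu₁ : u₁ ∈ U) (hk : ∀ u ∈ insert w U, (Q.neighborFinset u ∩ K).card ≤ k)
    (h₁ : 3 ≤ (Q.neighborFinset u₁ ∩ insert w U).card)
    (hw : 2 ≤ (Q.neighborFinset w ∩ insert w U).card)
    (hw₁ : (Q.neighborFinset w ∩ U.erase u₁).card ≤ 1)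
    (hconn : ∀ T ⊆ U.erase u₁, T.Nonempty →
      ∃ t ∈ T, ∃ t' ∈ (insert w U).erase u₁, t' ∉ T ∧ Q.Adj t t')
    {c : V → ℕ} (hc : ListColors Q L (K \ insert w U) c) :
    ∃ c', (∀ v ∈ K \ insert w U, c' v = c v) ∧ ListColors Q L K c' := by
  set F := insert w U with hF
  have hFK : F ⊆ K := Finset.insert_subset hwK hUK
  have hu₁F : u₁ ∈ F := Finset.mem_insert_of_mem hu₁
  have hwu₁ : w ≠ u₁ := fun h => hwU (h ▸ hu₁)
  have havail : ∀ u ∈ F, (Q.neighborFinset u ∩ F).card ≤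
      (L u \ (Q.neighborFinset u ∩ (K \ F)).image c).card := by
    intro u hu
    have h1 := hk u hu
    have h2 : (Q.neighborFinset u ∩ F).card + (Q.neighborFinset u ∩ (K \ F)).card =
        (Q.neighborFinset u ∩ K).card := by
      rw [← Finset.card_union_of_disjoint, ← Finset.inter_union_distrib_left,
        Finset.union_sdiff_of_subset hFK]
      exact Finset.disjoint_sdiff.mono Finset.inter_subset_right Finset.inter_subset_right
    have h3 := card_sdiff_image_add_le (K \ F) (Q.neighborFinset u) (L u) c (hL u) (by omega)
    omega
  obtain ⟨B, hB, hB2⟩ := Finset.exists_subset_card_eq (hw.trans (havail w (by simp [hF])))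
  obtain ⟨x, hx, hxB⟩ := Finset.exists_mem_notMem_of_card_lt_card
    (show B.card < _ from (by omega : B.card < 3).trans_le (h₁.trans (havail u₁ hu₁F)))
  obtain ⟨hxL, hxc⟩ := Finset.mem_sdiff.1 hx
  have hu₁P : u₁ ∉ K \ F := fun h => (Finset.mem_sdiff.1 h).2 hu₁F
  have hc₁ := hc.update hu₁P hxL fun u hu hadj hux =>
    hxc (Finset.mem_image.2 ⟨u, by simpa [hadj] using hu, hux⟩)
  set c₁ := Function.update c u₁ x with hc₁def
  have hPX : Disjoint (insert u₁ (K \ F)) (F.erase u₁) := by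
    rw [Finset.disjoint_left]
    intro v hv hv'
    obtain ⟨hne, hv'⟩ := Finset.mem_erase.1 hv'
    rcases Finset.mem_insert.1 hv with h | h
    · exact hne h
    · exact (Finset.mem_sdiff.1 h).2 hv'
  have hPK : insert u₁ (K \ F) ⊆ K :=
    Finset.insert_subset (hUK hu₁) Finset.sdiff_subset
  obtain ⟨c', hcc', hc'⟩ := hc₁.extend Q L _ (F.erase u₁) hPX fun T hT hTne => by
    by_cases hwT : w ∈ T
    · refine ⟨w, hwT, ?_⟩
      have hle : (Q.neighborFinset w ∩ T).card ≤ (Q.neighborFinset w ∩ U.erase u₁).card := by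
        refine Finset.card_le_card fun t ht => ?_
        obtain ⟨ht, htT⟩ := Finset.mem_inter.1 ht
        have hne : t ≠ w := fun h => by simp [h] at ht
        have := hT htT
        simp only [hF, Finset.mem_erase, Finset.mem_insert, hne, false_or] at this
        simp only [Finset.mem_inter, Finset.mem_erase]
        exact ⟨ht, this⟩
      have hBle : B ⊆ L w \ (Q.neighborFinset w ∩ insert u₁ (K \ F)).image c₁ := by
        intro b hb
        obtain ⟨hbL, hbc⟩ := Finset.mem_sdiff.1 (hB hb)
        refine Finset.mem_sdiff.2 ⟨hbL, fun h => ?_⟩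
        obtain ⟨v, hv, rfl⟩ := Finset.mem_image.1 h
        obtain ⟨hvw, hv⟩ := Finset.mem_inter.1 hv
        rcases Finset.mem_insert.1 hv with rfl | hv'
        · exact hxB (by simpa [hc₁def] using hb)
        · refine hbc (Finset.mem_image.2 ⟨v, Finset.mem_inter.2 ⟨hvw, hv'⟩, ?_⟩)
          rw [hc₁def, Function.update_of_ne (by rintro rfl; exact hu₁P hv')]
      have := Finset.card_le_card hBle
      omega
    · have hTU : T ⊆ U.erase u₁ := fun t ht => by
        have hne : t ≠ w := fun h => hwT (h ▸ ht)
        have := hT ht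
        simp only [hF, Finset.mem_erase, Finset.mem_insert, hne, false_or] at this
        exact Finset.mem_erase.2 this
      obtain ⟨t, ht, t', ht', ht'T, hadj⟩ := hconn T hTU hTne
      refine ⟨t, ht, ?_⟩
      have ht'P : t' ∉ insert u₁ (K \ F) := fun h => Finset.disjoint_left.1 hPX h ht'
      have hdis : Disjoint (insert t' (Q.neighborFinset t ∩ T))
          (Q.neighborFinset t ∩ insert u₁ (K \ F)) := by
        rw [Finset.disjoint_insert_left]
        exact ⟨fun h => ht'P (Finset.mem_inter.1 h).2,
          hPX.symm.mono (Finset.inter_subset_right.trans hT) Finset.inter_subset_right⟩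
      have hsub : insert t' (Q.neighborFinset t ∩ T) ∪ (Q.neighborFinset t ∩ insert u₁ (K \ F)) ⊆
          Q.neighborFinset t ∩ K := by
        refine Finset.union_subset (Finset.insert_subset ?_ ?_)
          (Finset.inter_subset_inter_left hPK)
        · exact Finset.mem_inter.2 ⟨by simpa using hadj, hFK (Finset.mem_of_mem_erase ht')⟩
        · exact Finset.inter_subset_inter_left
            (hT.trans ((Finset.erase_subset _ _).trans hFK))
      have h1 := Finset.card_le_card hsub
      rw [Finset.card_union_of_disjoint hdis, Finset.card_insert_of_notMem
        (fun h => ht'T (Finset.mem_inter.1 h).2)] at h1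
      have h2 := hk t (Finset.mem_of_mem_erase (hT ht))
      have h3 := card_sdiff_image_add_le (insert u₁ (K \ F)) (Q.neighborFinset t) (L t) c₁
        (hL t) (by omega)
      omega
  refine ⟨c', fun v hv => ?_, ?_⟩
  · rw [hcc' v (Finset.mem_insert_of_mem hv), hc₁def,
      Function.update_of_ne (by rintro rfl; exact hu₁P hv)]
  · have : insert u₁ (K \ F) ∪ F.erase u₁ = K := by
      rw [Finset.insert_union, ← Finset.union_insert, Finset.insert_erase hu₁F,
        Finset.sdiff_union_of_subset hFK]
    rwa [this] at hc'

/-- The situation in a minimal counterexample `G`, where `K` is the `(D + 2)`-core of the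
conflict graph: no coloring of a part of `K` that comes from a proper subgraph of `G` extends
to `K`. -/
structure Critical (G : SimpleGraph V) [DecidableRel G.Adj] (D : ℕ) (L : V → Finset ℕ)
    (K : Finset V) : Prop where
  four_le : 4 ≤ D
  degree_le : ∀ v, G.degree v ≤ D
  card_list : ∀ v, D + 2 ≤ (L v).card
  core : ∀ v ∈ K, D + 2 ≤ ((conflictGraph G).neighborFinset v ∩ K).card
  irreducible : ∀ F ⊆ K, ∀ G' < G,
    (∀ a ∈ K \ F, ∀ b ∈ K \ F, (conflictGraph G).Adj a b → (conflictGraph G').Adj a b) →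
    ∃ c : V → ℕ, ListColors (conflictGraph G) L (K \ F) c ∧
      ∀ c', (∀ v ∈ K \ F, c' v = c v) → ¬ ListColors (conflictGraph G) L K c'

theorem card_conflict_le (G : SimpleGraph V) [DecidableRel G.Adj] (K : Finset V) (v : V) :
    ((conflictGraph G).neighborFinset v ∩ K).card ≤
      ∑ w ∈ G.neighborFinset v, ((G.neighborFinset w).erase v ∩ K).card := by
  refine (Finset.card_le_card fun u hu => ?_).trans Finset.card_biUnion_le
  obtain ⟨hu, huK⟩ := Finset.mem_inter.1 hu
  obtain ⟨hne, w, hvw, huw⟩ := (mem_neighborFinset _ _ _).1 hu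
  simp only [Finset.mem_biUnion, Finset.mem_inter, Finset.mem_erase, mem_neighborFinset]
  exact ⟨w, hvw, ⟨hne.symm, huw.symm⟩, huK⟩

theorem card_erase_inter_le (G : SimpleGraph V) [DecidableRel G.Adj] (K : Finset V) {v w : V}
    (h : G.Adj v w) : ((G.neighborFinset w).erase v ∩ K).card + 1 ≤ G.degree w := by
  have h1 : v ∈ G.neighborFinset w := by simpa using h.symm
  have h2 := Finset.card_le_card
    (Finset.inter_subset_left : (G.neighborFinset w).erase v ∩ K ⊆ _)
  have h3 := Finset.card_erase_add_one h1
  rw [card_neighborFinset_eq_degree] at h3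
  omega

theorem neighborFinset_eq_pair {G : SimpleGraph V} [DecidableRel G.Adj] {u x : V}
    (hu : G.degree u = 2) (hux : G.Adj u x) : ∃ z, z ≠ x ∧ G.neighborFinset u = {x, z} := by
  rw [← card_neighborFinset_eq_degree, Finset.card_eq_two] at hu
  obtain ⟨a, b, hab, hN⟩ := hu
  have hx : x ∈ G.neighborFinset u := by simpa using hux
  rw [hN, Finset.mem_insert, Finset.mem_singleton] at hx
  rcases hx with rfl | rfl
  · exact ⟨b, hab.symm, hN⟩
  · exact ⟨a, hab, by rw [hN, Finset.pair_comm]⟩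

/-- A `3`-vertex with a `2`-neighbor. -/
abbrev IsNeedy (G : SimpleGraph V) [DecidableRel G.Adj] (v : V) : Prop :=
  G.degree v = 3 ∧ ∃ u, G.Adj v u ∧ G.degree u = 2

/-- A `3`-vertex with a `2`-neighbor and a `3`-neighbor. -/
abbrev IsPoor (G : SimpleGraph V) [DecidableRel G.Adj] (v : V) : Prop :=
  IsNeedy G v ∧ ∃ a, G.Adj v a ∧ G.degree a = 3

/-- The `4`-vertices outside `K` with at least three neighbors of degree two or poor. -/
def rich (G : SimpleGraph V) [DecidableRel G.Adj] (K : Finset V) : Finset V :=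
  Finset.univ.filter fun y => y ∉ K ∧ G.degree y = 4 ∧
    3 ≤ ((G.neighborFinset y).filter fun w => G.degree w = 2 ∨ IsPoor G w).card

/-- The `2`-vertices with a rich neighbor. -/
def threads (G : SimpleGraph V) [DecidableRel G.Adj] (K : Finset V) : Finset V :=
  Finset.univ.filter fun u => G.degree u = 2 ∧ ∃ y ∈ rich G K, G.Adj u y

theorem mem_rich {G : SimpleGraph V} [DecidableRel G.Adj] {K : Finset V} {y : V} :
    y ∈ rich G K ↔ y ∉ K ∧ G.degree y = 4 ∧
      3 ≤ ((G.neighborFinset y).filter fun w => G.degree w = 2 ∨ IsPoor G w).card := by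
  simp [rich]

namespace Critical

variable {G : SimpleGraph V} [DecidableRel G.Adj] {D : ℕ} {L : V → Finset ℕ} {K : Finset V}

theorem core_sum (h : Critical G D L K) {v : V} (hv : v ∈ K) :
    D + 2 ≤ ∑ w ∈ G.neighborFinset v, ((G.neighborFinset w).erase v ∩ K).card :=
  (h.core v hv).trans (card_conflict_le G K v)

theorem exists_mem_core_of_lt (h : Critical G D L K) {G' : SimpleGraph V} (hG' : G' < G) :
    ∃ a ∈ K, ∃ b ∈ K, (conflictGraph G).Adj a b ∧ ¬ (conflictGraph G').Adj a b := by
  by_contra! hcon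
  obtain ⟨c, hc, hext⟩ := h.irreducible ∅ (by simp) G' hG'
    (fun a ha b hb => hcon a (by simpa using ha) b (by simpa using hb))
  exact hext c (fun _ _ => rfl) (by simpa using hc)

theorem mem_core_of_adj (h : Critical G D L K) {x y : V} (hxy : G.Adj x y) (hx : x ∉ K) :
    y ∈ K := by
  by_contra hy
  obtain ⟨a, ha, b, hb, ⟨hne, w, haw, hbw⟩, hn⟩ := h.exists_mem_core_of_lt (deleteEdge_lt hxy)
  refine hn ⟨hne, w, ?_, ?_⟩ <;> simp only [deleteEdges_adj, Set.mem_singleton_iff, Sym2.eq_iff]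
  · refine ⟨haw, ?_⟩
    rintro (⟨rfl, -⟩ | ⟨rfl, -⟩) <;> contradiction
  · refine ⟨hbw, ?_⟩
    rintro (⟨rfl, -⟩ | ⟨rfl, -⟩) <;> contradiction

theorem degree_ne_one (h : Critical G D L K) (v : V) : G.degree v ≠ 1 := by
  intro hv
  rw [degree_eq_one_iff_existsUnique_adj] at hv
  obtain ⟨w, hvw, huniq⟩ := hv
  have hN : G.neighborFinset v = {w} := by
    ext x
    simp only [mem_neighborFinset, Finset.mem_singleton]
    exact ⟨fun hx => huniq x hx, fun hx => hx ▸ hvw⟩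
  have hvK : v ∉ K := fun hv => by
    have h1 := h.core_sum hv
    rw [hN, Finset.sum_singleton] at h1
    have h2 := card_erase_inter_le G K hvw
    have h3 := h.degree_le w
    omega
  obtain ⟨a, ha, b, hb, ⟨hne, m, ham, hbm⟩, hn⟩ := h.exists_mem_core_of_lt (deleteEdge_lt hvw)
  have hm : m ≠ v := by
    rintro rfl
    exact hne ((huniq a ham.symm).trans (huniq b hbm.symm).symm)
  refine hn ⟨hne, m, ?_, ?_⟩ <;> simp only [deleteEdges_adj, Set.mem_singleton_iff, Sym2.eq_iff]
  · refine ⟨ham, ?_⟩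
    rintro (⟨rfl, -⟩ | ⟨-, h⟩) <;> contradiction
  · refine ⟨hbm, ?_⟩
    rintro (⟨rfl, -⟩ | ⟨-, h⟩) <;> contradiction

theorem adj_four_le (h : Critical G D L K) {u x : V} (hu : G.degree u = 2) (huK : u ∈ K)
    (hux : G.Adj u x) : 4 ≤ G.degree x := by
  obtain ⟨z, hzx, hN⟩ := neighborFinset_eq_pair hu hux
  have hz : G.Adj u z := by rw [← mem_neighborFinset, hN]; simp
  have h1 := h.core_sum huK
  rw [hN, Finset.sum_pair hzx.symm] at h1
  have h2 := card_erase_inter_le G K hux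
  have h3 := card_erase_inter_le G K hz
  have h4 := h.degree_le z
  omega

theorem adj_three_le (h : Critical G D L K) {u x : V} (hu : G.degree u = 2)
    (hux : G.Adj u x) : 3 ≤ G.degree x := by
  by_cases huK : u ∈ K
  · have := h.adj_four_le hu huK hux
    omega
  have hxK := h.mem_core_of_adj hux huK
  have h1 := h.degree_ne_one x
  have h0 : 0 < G.degree x := (G.degree_pos_iff_exists_adj x).2 ⟨u, hux.symm⟩
  by_contra hlt
  have := h.adj_four_le (show G.degree x = 2 by omega) hxK hux.symm
  omega

theorem mem_core_of_three (h : Critical G D L K) {u v : V} (hv : G.degree v = 3)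
    (hu : G.degree u = 2) (huv : G.Adj u v) : u ∉ K ∧ v ∈ K := by
  have huK : u ∉ K := fun huK => by
    have := h.adj_four_le hu huK huv
    omega
  exact ⟨huK, h.mem_core_of_adj huv huK⟩

theorem degree_add_degree_of_three (h : Critical G D L K) {u v a b : V} (hv : G.degree v = 3)
    (hu : G.degree u = 2) (hua : u ≠ a) (hub : u ≠ b) (hab : a ≠ b)
    (hN : G.neighborFinset v = {u, a, b}) : D + 3 ≤ G.degree a + G.degree b := by
  have hvu : G.Adj v u := by rw [← mem_neighborFinset, hN]; simp
  have hva : G.Adj v a := by rw [← mem_neighborFinset, hN]; simp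
  have hvb : G.Adj v b := by rw [← mem_neighborFinset, hN]; simp
  have h1 := h.core_sum (h.mem_core_of_three hv hu hvu.symm).2
  rw [hN, Finset.sum_insert (by simp [hua, hub]), Finset.sum_pair hab] at h1
  have h2 := card_erase_inter_le G K hvu
  have h3 := card_erase_inter_le G K hva
  have h4 := card_erase_inter_le G K hvb
  omega

theorem thread_mem_core (h : Critical G D L K) {u : V} (hu : u ∈ threads G K) : u ∈ K := by
  obtain ⟨-, y, hy, huy⟩ := (Finset.mem_filter.1 hu).2
  exact h.mem_core_of_adj huy.symm (mem_rich.1 hy).1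

theorem card_conflict_thread_le (h : Critical G D L K) {u : V} (hu : u ∈ threads G K) :
    ((conflictGraph G).neighborFinset u ∩ K).card ≤ D + 2 := by
  obtain ⟨hu2, y, hy, huy⟩ := (Finset.mem_filter.1 hu).2
  obtain ⟨z, hzy, hN⟩ := neighborFinset_eq_pair hu2 huy
  have hz : G.Adj u z := by rw [← mem_neighborFinset, hN]; simp
  refine (card_conflict_le G K u).trans ?_
  rw [hN, Finset.sum_pair hzy.symm]
  have h2 := card_erase_inter_le G K huy
  have h3 := card_erase_inter_le G K hz
  have h4 := h.degree_le z
  have h5 := (mem_rich.1 hy).2.1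
  omega

theorem thread_injective (h : Critical G D L K) {u v : V} (hu : u ∈ threads G K)
    (huv : G.neighborFinset u = G.neighborFinset v) : u = v := by
  by_contra hne
  have huK := h.thread_mem_core hu
  obtain ⟨hu2, y, hy, huy⟩ := (Finset.mem_filter.1 hu).2
  obtain ⟨z, hzy, hN⟩ := neighborFinset_eq_pair hu2 huy
  have hvy : G.Adj v y := by rw [← mem_neighborFinset, ← huv, hN]; simp
  have hvz : G.Adj v z := by rw [← mem_neighborFinset, ← huv, hN]; simp
  have huz : G.Adj u z := by rw [← mem_neighborFinset, hN]; simp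
  have hsub : (conflictGraph G).neighborFinset u ∩ K ⊆
      (G.neighborFinset y).erase u ∪ ((G.neighborFinset z).erase u).erase v := by
    intro t ht
    obtain ⟨htu, m, hum, htm⟩ := (mem_neighborFinset _ _ _).1 (Finset.mem_inter.1 ht).1
    have hm : m ∈ G.neighborFinset u := by simpa using hum
    simp only [Finset.mem_union, Finset.mem_erase, mem_neighborFinset]
    rw [hN, Finset.mem_insert, Finset.mem_singleton] at hm
    rcases hm with rfl | rfl
    · exact Or.inl ⟨htu.symm, htm.symm⟩
    · by_cases htv : t = v
      · exact Or.inl ⟨htu.symm, htv ▸ hvy.symm⟩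
      · exact Or.inr ⟨htv, htu.symm, htm.symm⟩
  have h1 := (h.core u huK).trans ((Finset.card_le_card hsub).trans (Finset.card_union_le _ _))
  rw [Finset.card_erase_of_mem (by simp [huy.symm]), Finset.card_erase_of_mem
    (by simp [hvz.symm, Ne.symm hne]), Finset.card_erase_of_mem (by simp [huz.symm]),
    card_neighborFinset_eq_degree, card_neighborFinset_eq_degree, (mem_rich.1 hy).2.1] at h1
  have h2 := h.degree_le z
  have h3 := h.four_le
  omega

theorem two_thread_or_poor (_h : Critical G D L K) {y w : V} (hy : y ∈ rich G K)
    (hyw : G.Adj y w) (hw : G.degree w = 2 ∨ IsPoor G w) :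
    w ∈ threads G K ∨ ∃ u a, G.degree u = 2 ∧ G.degree a = 3 ∧
      G.neighborFinset w = {y, u, a} := by
  rcases hw with hw | ⟨⟨hw3, u, hwu, hu⟩, a, hwa, ha⟩
  · exact Or.inl (Finset.mem_filter.2 ⟨Finset.mem_univ _, hw, y, hy, hyw.symm⟩)
  · have hy4 := (mem_rich.1 hy).2.1
    refine Or.inr ⟨u, a, hu, ha, (Finset.eq_of_subset_of_card_le ?_ ?_).symm⟩
    · intro x hx
      simp only [Finset.mem_insert, Finset.mem_singleton] at hx
      rcases hx with rfl | rfl | rfl <;> simp [hyw.symm, hwu, hwa]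
    · rw [card_neighborFinset_eq_degree, hw3, Finset.card_eq_three.2 ⟨y, u, a, ?_, ?_, ?_, rfl⟩] <;>
        rintro rfl <;> omega

/-- The threads at rich vertices form a forest. -/
theorem threads_sparse (h : Critical G D L K) (W : Finset V) (hW : W.Nonempty) :
    ((threads G K).filter (G.neighborFinset · ⊆ W)).card < W.card := by
  by_contra! hdense
  obtain ⟨W, hW, hd, hreg, hmin⟩ := exists_minimal_dense (threads G K) (G.neighborFinset ·)
    (fun u hu => by rw [card_neighborFinset_eq_degree]; exact (Finset.mem_filter.1 hu).2.1)
    (fun u hu v _ huv => h.thread_injective hu huv) W hW hdense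
  clear hdense
  set U := (threads G K).filter (G.neighborFinset · ⊆ W) with hU
  have hUK : U ⊆ K := fun u hu => h.thread_mem_core (Finset.mem_filter.1 hu).1
  obtain ⟨u₀, hu₀⟩ : U.Nonempty := Finset.card_pos.1 (hW.card_pos.trans_le hd)
  obtain ⟨hu₀E, hu₀W⟩ := Finset.mem_filter.1 hu₀
  obtain ⟨-, y, hy, huy⟩ := (Finset.mem_filter.1 hu₀E).2
  have hyW : y ∈ W := hu₀W (by simpa using huy)
  obtain ⟨hyK, hy4, hy3⟩ := mem_rich.1 hy
  obtain ⟨u₁, u₂, hu₁₂, hyU⟩ := Finset.card_eq_two.1 (hreg y hyW)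
  have hmemU : ∀ t ∈ U, G.Adj t y → t = u₁ ∨ t = u₂ := fun t ht hty => by
    have : t ∈ ({u₁, u₂} : Finset V) := hyU ▸ Finset.mem_filter.2 ⟨ht, by simpa using hty⟩
    simpa using this
  have hu₁ : u₁ ∈ U ∧ G.Adj u₁ y := by
    have : u₁ ∈ ({u₁, u₂} : Finset V) := by simp
    rw [← hyU] at this
    simpa using this
  have hu₂ : u₂ ∈ U ∧ G.Adj u₂ y := by
    have : u₂ ∈ ({u₁, u₂} : Finset V) := by simp
    rw [← hyU] at this
    simpa using this
  obtain ⟨w, hw, hwu⟩ := Finset.exists_mem_notMem_of_card_lt_card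
    ((Finset.card_pair hu₁₂).trans_lt hy3)
  obtain ⟨hyw, hwtype⟩ := Finset.mem_filter.1 hw
  rw [mem_neighborFinset] at hyw
  have hwU : w ∉ U := fun hwU => hwu (by simpa using hmemU w hwU hyw.symm)
  have hwK : w ∈ K := h.mem_core_of_adj hyw hyK
  have hwtype := h.two_thread_or_poor hy hyw hwtype
  have hwle : ((conflictGraph G).neighborFinset w ∩ K).card ≤ D + 2 := by
    rcases hwtype with hw | ⟨u, a, hu, ha, hN⟩
    · exact h.card_conflict_thread_le hw
    · have hwu : G.Adj w u := by rw [← mem_neighborFinset, hN]; simp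
      have hwa : G.Adj w a := by rw [← mem_neighborFinset, hN]; simp
      refine (card_conflict_le G K w).trans ?_
      rw [hN, Finset.sum_insert, Finset.sum_pair]
      · have h1 := card_erase_inter_le G K hwu
        have h2 := card_erase_inter_le G K hwa
        have h3 := card_erase_inter_le G K hyw.symm
        have h4 := h.four_le
        omega
      · rintro rfl; omega
      · simp only [Finset.mem_insert, Finset.mem_singleton]
        rintro (rfl | rfl) <;> omega
  have hadj : ∀ {a b m : V}, a ≠ b → G.Adj a m → G.Adj b m → (conflictGraph G).Adj a b :=
    fun hab ham hbm => ⟨hab, _, ham, hbm⟩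
  have hwu₁ : w ≠ u₁ := fun h => hwU (h ▸ hu₁.1)
  have hwu₂ : w ≠ u₂ := fun h => hwU (h ▸ hu₂.1)
  obtain ⟨c, hc, hext⟩ := h.irreducible (insert w U) (Finset.insert_subset hwK hUK)
    (G.deleteEdges {s(y, u₁)}) (deleteEdge_lt hu₁.2.symm) fun a ha b hb ⟨hab, m, ham, hbm⟩ => by
      have hne : ∀ x ∈ K \ insert w U, x ≠ y ∧ x ≠ u₁ := fun x hx => by
        obtain ⟨hxK, hxF⟩ := Finset.mem_sdiff.1 hx
        exact ⟨fun h => hyK (h ▸ hxK), fun h => hxF (h ▸ Finset.mem_insert_of_mem hu₁.1)⟩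
      refine ⟨hab, m, ?_, ?_⟩ <;> simp [deleteEdges_adj, ham, hbm, hne a ha, hne b hb]
  suffices ∃ c', (∀ v ∈ K \ insert w U, c' v = c v) ∧ ListColors (conflictGraph G) L K c' by
    obtain ⟨c', hcc', hc'⟩ := this
    exact hext c' hcc' hc'
  refine hc.extend_flexible h.card_list hUK hwK hwU hu₁.1 ?_ ?_ ?_ ?_ ?_
  · intro u hu
    rcases Finset.mem_insert.1 hu with rfl | hu
    · exact hwle
    · exact h.card_conflict_thread_le (Finset.mem_filter.1 hu).1
  · obtain ⟨hu₁E, hu₁W⟩ := Finset.mem_filter.1 hu₁.1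
    obtain ⟨x, hxy, hN⟩ := neighborFinset_eq_pair (Finset.mem_filter.1 hu₁E).2.1 hu₁.2
    have hxW : x ∈ W := hu₁W (by rw [hN]; simp)
    have hux : G.Adj u₁ x := by rw [← mem_neighborFinset, hN]; simp
    obtain ⟨u', hu', hne⟩ := Finset.exists_mem_ne
      (show 1 < _ from by rw [hreg x hxW]; norm_num) u₁
    obtain ⟨hu'U, hu'x⟩ := Finset.mem_filter.1 hu'
    rw [mem_neighborFinset] at hu'x
    have hu'₂ : u' ≠ u₂ := by
      rintro rfl
      refine hu₁₂ (h.thread_injective hu₁E ?_)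
      rw [hN]
      refine Finset.eq_of_subset_of_card_le ?_ ?_
      · intro z hz
        simp only [Finset.mem_insert, Finset.mem_singleton] at hz
        rcases hz with rfl | rfl <;> simp [hu'x, hu₂.2]
      · rw [card_neighborFinset_eq_degree, Finset.card_pair hxy.symm,
          (Finset.mem_filter.1 (Finset.mem_filter.1 hu'U).1).2.1]
    have hwu' : w ≠ u' := fun h => hwU (h ▸ hu'U)
    rw [← Finset.card_eq_three.2 ⟨w, u₂, u', hwu₂, hwu', hu'₂.symm, rfl⟩]
    refine Finset.card_le_card fun z hz => ?_
    simp only [Finset.mem_insert, Finset.mem_singleton] at hz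
    simp only [Finset.mem_inter, mem_neighborFinset, Finset.mem_insert]
    rcases hz with rfl | rfl | rfl
    · exact ⟨hadj hwu₁.symm hu₁.2 hyw.symm, Or.inl rfl⟩
    · exact ⟨hadj hu₁₂ hu₁.2 hu₂.2, Or.inr hu₂.1⟩
    · exact ⟨hadj hne.symm hux hu'x, Or.inr hu'U⟩
  · rw [← Finset.card_pair hu₁₂]
    refine Finset.card_le_card fun z hz => ?_
    simp only [Finset.mem_insert, Finset.mem_singleton] at hz
    simp only [Finset.mem_inter, mem_neighborFinset, Finset.mem_insert]
    rcases hz with rfl | rfl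
    · exact ⟨hadj hwu₁ hyw.symm hu₁.2, Or.inr hu₁.1⟩
    · exact ⟨hadj hwu₂ hyw.symm hu₂.2, Or.inr hu₂.1⟩
  · refine (Finset.card_le_card (t := {u₂}) fun t ht => ?_).trans (by simp)
    obtain ⟨ht, htU⟩ := Finset.mem_inter.1 ht
    obtain ⟨htu₁, htU⟩ := Finset.mem_erase.1 htU
    obtain ⟨hwt, m, hwm, htm⟩ := (mem_neighborFinset _ _ _).1 ht
    rw [Finset.mem_singleton]
    by_cases hmy : m = y
    · exact (hmemU t htU (hmy ▸ htm)).resolve_left htu₁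
    exfalso
    obtain ⟨htE, htW⟩ := Finset.mem_filter.1 htU
    rcases hwtype with hwE | ⟨u, a, hu, ha, hN⟩
    · obtain ⟨z, hzy, hN⟩ := neighborFinset_eq_pair (Finset.mem_filter.1 hwE).2.1 hyw.symm
      have hm : m ∈ G.neighborFinset w := by simpa using hwm
      rw [hN, Finset.mem_insert, Finset.mem_singleton] at hm
      obtain rfl := hm.resolve_left hmy
      refine hwU (Finset.mem_filter.2 ⟨hwE, ?_⟩)
      rw [hN]
      exact Finset.insert_subset hyW (Finset.singleton_subset_iff.2 (htW (by simpa using htm)))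
    · have hm : m ∈ G.neighborFinset w := by simpa using hwm
      rw [hN, Finset.mem_insert, Finset.mem_insert, Finset.mem_singleton] at hm
      have := h.adj_four_le (Finset.mem_filter.1 htE).2.1 (hUK htU) htm
      rcases hm.resolve_left hmy with rfl | rfl <;> omega
  · intro T hT hTne
    by_cases h₂ : u₂ ∈ T
    · refine ⟨u₂, h₂, w, ?_, ?_, hadj hwu₂.symm hu₂.2 hyw.symm⟩
      · exact Finset.mem_erase.2 ⟨hwu₁, Finset.mem_insert_self _ _⟩
      · exact fun hwT => hwU (Finset.mem_of_mem_erase (hT hwT))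
    · obtain ⟨t, ht, t', ht'U, ht'₁, ht'T, x, hxt, hxt'⟩ := exists_adjacent_outside (threads G K)
        (G.neighborFinset ·)
        (fun u hu => by rw [card_neighborFinset_eq_degree]; exact (Finset.mem_filter.1 hu).2.1)
        W hreg hmin hyW hyU (hT.trans (Finset.erase_subset _ _)) hTne
        (fun h => Finset.ne_of_mem_erase (hT h) rfl) h₂
      rw [mem_neighborFinset] at hxt hxt'
      exact ⟨t, ht, t', Finset.mem_erase.2 ⟨ht'₁, Finset.mem_insert_of_mem ht'U⟩, ht'T,
        hadj (fun h => ht'T (h ▸ ht)) hxt hxt'⟩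

theorem sum_card_two_le (h : Critical G D L K) :
    2 * ∑ y ∈ rich G K, ((G.neighborFinset y).filter (G.degree · = 2)).card ≤
      4 * (rich G K).card +
        2 * ((threads G K).biUnion (G.neighborFinset ·) \ rich G K).card := by
  rcases (rich G K).eq_empty_or_nonempty with hempty | hne
  · simp [hempty]
  set I := rich G K with hI
  set E := threads G K
  set M := E.biUnion (G.neighborFinset ·) \ I with hM
  have h1 : (E.filter (G.neighborFinset · ⊆ I)).card < I.card := h.threads_sparse I hne
  have h2 : E.card < I.card + M.card := by
    have h2 := h.threads_sparse (I ∪ M) (hne.mono Finset.subset_union_left)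
    rwa [Finset.card_union_of_disjoint Finset.disjoint_sdiff, Finset.filter_true_of_mem] at h2
    intro u hu
    rw [hM, Finset.union_sdiff_self_eq_union]
    exact (Finset.subset_biUnion_of_mem (G.neighborFinset ·) hu).trans Finset.subset_union_right
  have h3 : ∑ y ∈ I, ((G.neighborFinset y).filter (G.degree · = 2)).card =
      ∑ u ∈ E, (G.neighborFinset u ∩ I).card := by
    have := Finset.sum_card_bipartiteAbove_eq_sum_card_bipartiteBelow
      (s := I) (t := E) (fun y u => y ∈ G.neighborFinset u)
    simp only [Finset.bipartiteAbove, Finset.bipartiteBelow] at this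
    convert this using 2 with y hy u hu
    · congr 1
      ext u
      simp only [Finset.mem_filter, mem_neighborFinset]
      exact ⟨fun ⟨hyu, hu⟩ => ⟨Finset.mem_filter.2 ⟨Finset.mem_univ _, hu, y, hy, hyu.symm⟩,
        hyu.symm⟩, fun ⟨hu, huy⟩ => ⟨huy.symm, (Finset.mem_filter.1 hu).2.1⟩⟩
    · congr 1
      ext y
      simp [and_comm]
  have h4 : ∑ u ∈ E, (G.neighborFinset u ∩ I).card ≤
      ∑ u ∈ E, (1 + if G.neighborFinset u ⊆ I then 1 else 0) := by
    refine Finset.sum_le_sum fun u hu => ?_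
    have hu2 : (G.neighborFinset u).card = 2 := by
      rw [card_neighborFinset_eq_degree]
      exact (Finset.mem_filter.1 hu).2.1
    split_ifs with hsub
    · exact (Finset.card_le_card Finset.inter_subset_left).trans hu2.le
    · have : G.neighborFinset u ∩ I ⊂ G.neighborFinset u :=
        Finset.ssubset_iff_subset_ne.2
          ⟨Finset.inter_subset_left, fun h => hsub (Finset.inter_eq_left.1 h)⟩
      have := Finset.card_lt_card this
      omega
  rw [Finset.sum_add_distrib, ← Finset.card_filter] at h4
  simp only [Finset.sum_const, smul_eq_mul, mul_one] at h4
  rw [h3]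
  change _ ≤ 4 * I.card + 2 * M.card
  omega

theorem card_two_add_card_needy_le (y : V) :
    ((G.neighborFinset y).filter (G.degree · = 2)).card +
      ((G.neighborFinset y).filter (IsNeedy G ·)).card ≤ G.degree y := by
  rw [← Finset.card_union_of_disjoint, ← card_neighborFinset_eq_degree]
  · exact Finset.card_le_card
      (Finset.union_subset (Finset.filter_subset _ _) (Finset.filter_subset _ _))
  · refine Finset.disjoint_filter.2 fun w _ h1 h2 => ?_
    have := h2.1
    omega

omit [DecidableEq V] in
theorem card_poor_le_card_needy (y : V) :
    ((G.neighborFinset y).filter (IsPoor G ·)).card ≤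
      ((G.neighborFinset y).filter (IsNeedy G ·)).card :=
  Finset.card_le_card (Finset.monotone_filter_right _ fun _ _ h => h.1)

theorem card_two_add_card_poor (y : V) :
    ((G.neighborFinset y).filter (G.degree · = 2)).card +
      ((G.neighborFinset y).filter (IsPoor G ·)).card =
      ((G.neighborFinset y).filter fun w => G.degree w = 2 ∨ IsPoor G w).card := by
  rw [Finset.filter_or, Finset.card_union_of_disjoint]
  refine Finset.disjoint_filter.2 fun w _ h1 h2 => ?_
  have := h2.1.1
  omega

theorem card_erase_inter_core_le_one (h : Critical G D L K) {z w : V} (hz : G.degree z = 4)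
    (hzw : G.Adj z w) (hw : G.degree w = 2 ∨ IsNeedy G w) :
    ((G.neighborFinset w).erase z ∩ K).card ≤ 1 := by
  rcases hw with hw | ⟨hw, u, hwu, hu⟩
  · have := card_erase_inter_le G K hzw
    omega
  · have huK := (h.mem_core_of_three hw hu hwu.symm).1
    have hsub : (G.neighborFinset w).erase z ∩ K ⊆ ((G.neighborFinset w).erase z).erase u := by
      intro x hx
      obtain ⟨hx, hxK⟩ := Finset.mem_inter.1 hx
      exact Finset.mem_erase.2 ⟨fun h => huK (h ▸ hxK), hx⟩
    have huz : u ≠ z := by rintro rfl; omega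
    have h1 := Finset.card_le_card hsub
    rw [Finset.card_erase_of_mem (by simp [huz, hwu]), Finset.card_erase_of_mem
      (by simp [hzw.symm]), card_neighborFinset_eq_degree] at h1
    omega

/-- A `4`-vertex of the core has at most three neighbors of degree two or needy, and at most two
if it is adjacent to a thread. -/
theorem card_two_add_card_needy_of_core (h : Critical G D L K) {z : V} (hz : G.degree z = 4)
    (hzK : z ∈ K) :
    ((G.neighborFinset z).filter (G.degree · = 2)).card +
      ((G.neighborFinset z).filter (IsNeedy G ·)).card ≤
        if ∃ w ∈ threads G K, G.Adj z w then 2 else 3 := by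
  set C := (G.neighborFinset z).filter fun w => G.degree w = 2 ∨ IsNeedy G w with hC
  have hCcard : ((G.neighborFinset z).filter (G.degree · = 2)).card +
      ((G.neighborFinset z).filter (IsNeedy G ·)).card = C.card := by
    rw [hC, Finset.filter_or, Finset.card_union_of_disjoint]
    refine Finset.disjoint_filter.2 fun w _ h1 h2 => ?_
    have := h2.1
    omega
  rw [hCcard]
  have h1 := h.core_sum hzK
  rw [← Finset.sum_filter_add_sum_filter_not _ (fun w => G.degree w = 2 ∨ IsNeedy G w), ← hC]
    at h1
  have hcard := Finset.card_filter_add_card_filter_not (s := G.neighborFinset z)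
    (fun w => G.degree w = 2 ∨ IsNeedy G w)
  rw [← hC, card_neighborFinset_eq_degree, hz] at hcard
  set C' := (G.neighborFinset z).filter fun w => ¬ (G.degree w = 2 ∨ IsNeedy G w) with hC'
  have h2 : ∑ w ∈ C', ((G.neighborFinset w).erase z ∩ K).card ≤ C'.card * (D - 1) := by
    refine Finset.sum_le_card_nsmul _ _ _ fun w hw => ?_
    have hzw : G.Adj z w := by simpa using (Finset.mem_filter.1 hw).1
    have := card_erase_inter_le G K hzw
    have := h.degree_le w
    omega
  have hone : ∀ w ∈ C, ((G.neighborFinset w).erase z ∩ K).card ≤ 1 := fun w hw => by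
    obtain ⟨hzw, hw⟩ := Finset.mem_filter.1 hw
    exact h.card_erase_inter_core_le_one hz (by simpa using hzw) hw
  have hD := h.four_le
  split_ifs with hex
  · obtain ⟨w, hw, hzw⟩ := hex
    obtain ⟨hw2, y, hy, hwy⟩ := (Finset.mem_filter.1 hw).2
    have hyK := (mem_rich.1 hy).1
    have hwC : w ∈ C := Finset.mem_filter.2 ⟨by simpa using hzw, Or.inl hw2⟩
    have hzero : ((G.neighborFinset w).erase z ∩ K).card = 0 := by
      obtain ⟨x, hxy, hN⟩ := neighborFinset_eq_pair hw2 hwy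
      have hz' : z ∈ G.neighborFinset w := by simpa using hzw.symm
      rw [Finset.card_eq_zero, Finset.eq_empty_iff_forall_notMem]
      intro t ht
      obtain ⟨ht, htK⟩ := Finset.mem_inter.1 ht
      obtain ⟨htz, ht⟩ := Finset.mem_erase.1 ht
      rw [hN, Finset.mem_insert, Finset.mem_singleton] at ht hz'
      rcases ht with rfl | rfl
      · exact hyK htK
      · rcases hz' with rfl | rfl
        · exact hyK hzK
        · exact htz rfl
    rw [← Finset.add_sum_erase _ _ hwC, hzero] at h1
    have h3 : ∑ w ∈ C.erase w, ((G.neighborFinset w).erase z ∩ K).card ≤ (C.erase w).card * 1 :=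
      Finset.sum_le_card_nsmul _ _ _ fun w hw => hone w (Finset.mem_of_mem_erase hw)
    rw [Finset.card_erase_of_mem hwC] at h3
    by_contra hlt
    have : C'.card * (D - 1) ≤ 1 * (D - 1) := Nat.mul_le_mul_right _ (by omega)
    rcases Nat.eq_zero_or_pos C'.card with h0 | h0
    · rw [h0] at h2
      omega
    · omega
  · have h3 : ∑ w ∈ C, ((G.neighborFinset w).erase z ∩ K).card ≤ C.card * 1 :=
      Finset.sum_le_card_nsmul _ _ _ hone
    by_contra hlt
    have h0 : C'.card = 0 := by omega
    rw [h0] at h2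
    omega

/-- The charge sent from `v` to its neighbor `w`. -/
def _root_.InjChoosable.transfer (G : SimpleGraph V) [DecidableRel G.Adj] (v w : V) : ℤ :=
  4 * (if 3 ≤ G.degree v ∧ G.degree w = 2 then 1 else 0) +
    (if 4 ≤ G.degree v ∧ IsNeedy G w then 1 else 0) +
    (if 4 ≤ G.degree v ∧ IsPoor G w then 1 else 0)

omit [DecidableEq V] in
theorem _root_.InjChoosable.transfer_nonneg (v w : V) : 0 ≤ transfer G v w := by
  unfold transfer
  split_ifs <;> norm_num

omit [DecidableEq V] in
theorem _root_.InjChoosable.sum_transfer_comm :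
    ∑ v, ∑ w ∈ G.neighborFinset v, transfer G v w =
      ∑ v, ∑ w ∈ G.neighborFinset v, transfer G w v :=
  Finset.sum_comm' (by simp [G.adj_comm])

omit [DecidableEq V] in
theorem _root_.InjChoosable.sum_transfer_of_four_le {v : V} (hv : 4 ≤ G.degree v) :
    ∑ w ∈ G.neighborFinset v, transfer G v w =
      4 * ((G.neighborFinset v).filter (G.degree · = 2)).card +
        ((G.neighborFinset v).filter (IsNeedy G ·)).card +
        ((G.neighborFinset v).filter (IsPoor G ·)).card := by
  simp only [transfer, hv, (by omega : 3 ≤ G.degree v), true_and, Finset.sum_add_distrib,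
    ← Finset.mul_sum, Finset.sum_boole]

theorem final_charge_three (h : Critical G D L K) {v : V} (hv : G.degree v = 3) :
    0 ≤ 2 - ∑ w ∈ G.neighborFinset v, transfer G v w +
      ∑ w ∈ G.neighborFinset v, transfer G w v := by
  by_cases hneedy : IsNeedy G v
  · obtain ⟨-, u, hvu, hu⟩ := hneedy
    have hcard : ((G.neighborFinset v).erase u).card = 2 := by
      rw [Finset.card_erase_of_mem (by simpa using hvu), card_neighborFinset_eq_degree, hv]
    obtain ⟨a, b, hab, hN⟩ := Finset.card_eq_two.1 hcard
    have ha : a ∈ (G.neighborFinset v).erase u := by rw [hN]; simp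
    have hb : b ∈ (G.neighborFinset v).erase u := by rw [hN]; simp
    obtain ⟨hau, hva⟩ := Finset.mem_erase.1 ha
    obtain ⟨hbu, hvb⟩ := Finset.mem_erase.1 hb
    rw [mem_neighborFinset] at hva hvb
    have hN' : G.neighborFinset v = {u, a, b} := by
      rw [← hN, Finset.insert_erase (by simpa using hvu)]
    have hsum := h.degree_add_degree_of_three hv hu hau.symm hbu.symm hab hN'
    have hda := h.degree_le a
    have hdb := h.degree_le b
    have hD := h.four_le
    have hneedy : IsNeedy G v := ⟨hv, u, hvu, hu⟩
    rw [hN', Finset.sum_insert (by simp [hau.symm, hbu.symm]), Finset.sum_pair hab,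
      Finset.sum_insert (by simp [hau.symm, hbu.symm]), Finset.sum_pair hab]
    have h1 : transfer G v u = 4 := by simp [transfer, hv, hu]
    have ha2 : G.degree a ≠ 2 := by omega
    have h2 : transfer G v a = 0 := by simp [transfer, hv, ha2]
    have hb2 : G.degree b ≠ 2 := by omega
    have h3 : transfer G v b = 0 := by simp [transfer, hv, hb2]
    have h4 := transfer_nonneg (G := G) u v
    have hge : ∀ x, 4 ≤ G.degree x → 1 ≤ transfer G x v := fun x hx => by
      simp only [transfer, hx, hneedy, true_and]
      split_ifs <;> norm_num
    have hge' : ∀ x, 4 ≤ G.degree x → IsPoor G v → 2 ≤ transfer G x v := fun x hx hp => by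
      simp only [transfer, hx, hneedy, true_and]
      split_ifs <;> norm_num
    have h5 := transfer_nonneg (G := G) a v
    have h6 := transfer_nonneg (G := G) b v
    rcases (show 3 ≤ G.degree a by omega).eq_or_lt with ha3 | ha4
    · have := hge' b (by omega) ⟨hneedy, a, hva, ha3.symm⟩
      omega
    · rcases (show 3 ≤ G.degree b by omega).eq_or_lt with hb3 | hb4
      · have := hge' a ha4 ⟨hneedy, b, hvb, hb3.symm⟩
        omega
      · have := hge a ha4
        have := hge b hb4
        omega
  · have h1 : ∑ w ∈ G.neighborFinset v, transfer G v w = 0 :=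
      Finset.sum_eq_zero fun w hw => by
        have hw2 : G.degree w ≠ 2 := fun hw2 => hneedy ⟨hv, w, by simpa using hw, hw2⟩
        simp [transfer, hv, hw2]
    have h2 : 0 ≤ ∑ w ∈ G.neighborFinset v, transfer G w v :=
      Finset.sum_nonneg fun w _ => transfer_nonneg w v
    omega

theorem final_charge_two (h : Critical G D L K) {v : V} (hv : G.degree v = 2) :
    0 ≤ -8 - ∑ w ∈ G.neighborFinset v, transfer G v w +
      ∑ w ∈ G.neighborFinset v, transfer G w v := by
  have h1 : ∑ w ∈ G.neighborFinset v, transfer G v w = 0 :=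
    Finset.sum_eq_zero fun w _ => by simp [transfer, hv]
  have h2 := Finset.card_nsmul_le_sum (G.neighborFinset v) (fun w => transfer G w v) 4
    fun w hw => by
      have h3 := h.adj_three_le hv (by simpa using hw)
      simp only [transfer, hv, h3, true_and]
      split_ifs <;> norm_num
  rw [card_neighborFinset_eq_degree, hv] at h2
  simp only [nsmul_eq_mul] at h2
  push_cast at h2
  omega

theorem final_charge_ge (h : Critical G D L K) (v : V) :
    (if v ∈ rich G K then 4 - 2 * (((G.neighborFinset v).filter (G.degree · = 2)).card : ℤ)
      else if v ∈ (threads G K).biUnion (G.neighborFinset ·) then 2 else 0) ≤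
    (if G.degree v = 0 then 0 else 10 * (G.degree v : ℤ) - 28) -
      ∑ w ∈ G.neighborFinset v, transfer G v w + ∑ w ∈ G.neighborFinset v, transfer G w v := by
  by_cases hlow : G.degree v < 4
  · have hI : v ∉ rich G K := fun hv => by
      have := (mem_rich.1 hv).2.1
      omega
    have hM : v ∉ (threads G K).biUnion (G.neighborFinset ·) := fun hv => by
      obtain ⟨u, hu, huv⟩ := Finset.mem_biUnion.1 hv
      have := h.adj_four_le (Finset.mem_filter.1 hu).2.1 (h.thread_mem_core hu)
        (by simpa using huv)
      omega
    rw [if_neg hI, if_neg hM]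
    have h1 := h.degree_ne_one v
    obtain h0 | h2 | h3 : G.degree v = 0 ∨ G.degree v = 2 ∨ G.degree v = 3 := by omega
    · have : G.neighborFinset v = ∅ := by
        rwa [← Finset.card_eq_zero, card_neighborFinset_eq_degree]
      simp [h0, this]
    · have := h.final_charge_two h2
      simp only [h2]
      simpa using this
    · have := h.final_charge_three h3
      simp only [h3]
      simpa using this
  · have h4 : 4 ≤ G.degree v := by omega
    have hin : 0 ≤ ∑ w ∈ G.neighborFinset v, transfer G w v :=
      Finset.sum_nonneg fun w _ => transfer_nonneg w v
    rw [sum_transfer_of_four_le h4, if_neg (by omega : G.degree v ≠ 0)]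
    have h1 := card_two_add_card_needy_le (G := G) v
    have h2 := card_poor_le_card_needy (G := G) v
    have h3 := card_two_add_card_poor (G := G) v
    by_cases hI : v ∈ rich G K
    · have := (mem_rich.1 hI).2.1
      rw [if_pos hI]
      omega
    rw [if_neg hI]
    rcases h4.lt_or_eq with h5 | h4
    · split_ifs <;> omega
    by_cases hvK : v ∈ K
    · have h6 := h.card_two_add_card_needy_of_core h4.symm hvK
      by_cases hM : v ∈ (threads G K).biUnion (G.neighborFinset ·)
      · obtain ⟨u, hu, huv⟩ := Finset.mem_biUnion.1 hM
        rw [if_pos ⟨u, hu, by simpa using ((mem_neighborFinset _ _ _).1 huv).symm⟩] at h6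
        rw [if_pos hM]
        omega
      · rw [if_neg hM]
        have h7 := h6.trans (show _ ≤ 3 by split_ifs <;> norm_num)
        omega
    · have h6 : ((G.neighborFinset v).filter fun w => G.degree w = 2 ∨ IsPoor G w).card < 3 := by
        by_contra hge
        exact hI (mem_rich.2 ⟨hvK, h4.symm, by omega⟩)
      split_ifs <;> omega

theorem charge_nonneg (h : Critical G D L K) :
    0 ≤ ∑ v, if G.degree v = 0 then (0 : ℤ) else 10 * (G.degree v : ℤ) - 28 := by
  have h1 := Finset.sum_le_sum fun v (_ : v ∈ Finset.univ) => h.final_charge_ge v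
  rw [Finset.sum_add_distrib, Finset.sum_sub_distrib, sum_transfer_comm, sub_add_cancel] at h1
  refine le_trans ?_ h1
  have h2 : (2 : ℤ) * ∑ y ∈ rich G K, (((G.neighborFinset y).filter (G.degree · = 2)).card : ℤ) ≤
      4 * ((rich G K).card : ℤ) +
        2 * (((threads G K).biUnion (G.neighborFinset ·) \ rich G K).card : ℤ) := by
    exact_mod_cast h.sum_card_two_le
  have h3 : ∀ v, (if v ∈ rich G K then
        4 - 2 * (((G.neighborFinset v).filter (G.degree · = 2)).card : ℤ)
      else if v ∈ (threads G K).biUnion (G.neighborFinset ·) then 2 else 0) =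
      (if v ∈ rich G K then
        4 - 2 * (((G.neighborFinset v).filter (G.degree · = 2)).card : ℤ) else 0) +
      if v ∈ (threads G K).biUnion (G.neighborFinset ·) \ rich G K then 2 else 0 := by
    intro v
    by_cases hI : v ∈ rich G K <;> simp [hI]
  simp only [h3]
  rw [Finset.sum_add_distrib, Finset.sum_ite_mem, Finset.sum_ite_mem, Finset.univ_inter,
    Finset.univ_inter, Finset.sum_sub_distrib, ← Finset.mul_sum]
  simp only [Finset.sum_const, nsmul_eq_mul]
  linarith

end Critical

end

end InjChoosable

namespace InjChoosable

/-- A graph whose nonempty subgraphs are sparse admits injective colorings of all of its subgraphs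
from lists exceeding the maximum degree by two. -/
theorem exists_injColoring_of_le {V : Type*} [Fintype V] [DecidableEq V] {G : SimpleGraph V}
    [DecidableRel G.Adj] (hΔ : 4 ≤ G.maxDegree)
    (hmad : ∀ H : G.Subgraph, H.verts.Nonempty →
      (2 * H.edgeSet.ncard : ℚ) / H.verts.ncard < 14 / 5)
    {L : V → Finset ℕ} (hL : ∀ v, G.maxDegree + 2 ≤ (L v).card) (G' : SimpleGraph V)
    (hG' : G' ≤ G) :
    ∃ c : V → ℕ, (∀ v, c v ∈ L v) ∧ IsInjColoring G' c := by
  classical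
  induction G' using WellFoundedLT.induction with
  | ind G' ih =>
  by_contra hno
  obtain ⟨K, hK, hKout⟩ := exists_core (conflictGraph G') (G.maxDegree + 2)
  have hcrit : Critical G' G.maxDegree L K := by
    refine ⟨hΔ, fun v => ?_, hL, hK, fun F hF G'' hlt hconf => ?_⟩
    · refine le_trans ?_ (G.degree_le_maxDegree v)
      rw [← card_neighborFinset_eq_degree, ← card_neighborFinset_eq_degree]
      refine Finset.card_le_card fun w hw => ?_
      rw [mem_neighborFinset] at hw ⊢
      exact hG' hw
    · obtain ⟨c, hc, hinj⟩ := ih G'' hlt (hlt.le.trans hG')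
      refine ⟨c, ⟨fun v _ => hc v, fun a ha b hb hab => ?_⟩, fun c' _ hc' => hno ?_⟩
      · obtain ⟨hne, m, ham, hbm⟩ := hconf a ha b hb hab
        exact hinj hne ⟨m, ham, hbm⟩
      · obtain ⟨d, hd⟩ := ListColors.extend_core hL hKout hc'
        exact ⟨d, fun v => hd.1 v (Finset.mem_univ v), fun a b hne ⟨m, ham, hbm⟩ =>
          hd.2 a (Finset.mem_univ a) b (Finset.mem_univ b) ⟨hne, m, ham, hbm⟩⟩
  have hcharge := hcrit.charge_nonneg
  let H : G.Subgraph :=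
    { verts := {v | G'.degree v ≠ 0}
      Adj := G'.Adj
      adj_sub := fun h => hG' h
      edge_vert := fun {v w} h => (G'.degree_pos_iff_exists_adj v).2 ⟨w, h⟩ |>.ne'
      symm := G'.symm }
  have hedge : H.edgeSet = G'.edgeSet := by
    ext e
    induction e with
    | _ a b => rfl
  have hne : H.verts.Nonempty := by
    by_contra hempty
    have hL' : ∀ v, ∃ x, x ∈ L v := fun v =>
      Finset.card_pos.1 ((Nat.succ_pos _).trans_le (hL v))
    choose c hc using hL'
    refine hno ⟨c, hc, fun a b _ ⟨m, ham, _⟩ => ?_⟩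
    exact (hempty ⟨a, H.edge_vert ham⟩).elim
  have hverts : H.verts.ncard = (Finset.univ.filter fun v => G'.degree v ≠ 0).card := by
    rw [← Set.ncard_coe_finset]
    congr 1
    ext v
    simp [H]
  have hcard : H.edgeSet.ncard = G'.edgeFinset.card := by
    rw [hedge, ← coe_edgeFinset, Set.ncard_coe_finset]
  have hmad := hmad H hne
  have hpos : 0 < H.verts.ncard := (Set.ncard_pos (Set.toFinite _)).2 hne
  rw [div_lt_iff₀ (by exact_mod_cast hpos), hcard, hverts] at hmad
  have hsum := G'.sum_degrees_eq_twice_card_edges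
  have hterm : ∀ v, (if G'.degree v = 0 then (0 : ℤ) else 10 * (G'.degree v : ℤ) - 28) =
      10 * (G'.degree v : ℤ) - 28 * if G'.degree v ≠ 0 then 1 else 0 := fun v => by
    by_cases h : G'.degree v = 0 <;> simp [h]
  simp only [hterm, Finset.sum_sub_distrib, ← Finset.mul_sum, Finset.sum_boole] at hcharge
  rw [← Nat.cast_sum, hsum] at hcharge
  have hcharge : (0 : ℚ) ≤ 10 * ((2 * G'.edgeFinset.card : ℕ) : ℚ) -
      28 * ((Finset.univ.filter fun v => G'.degree v ≠ 0).card : ℚ) := by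
    exact_mod_cast hcharge
  push_cast at hcharge
  linarith

end InjChoosable

/-- If `Δ(G) ≥ 4` and `mad(G) < 14/5`, then `G` is injectively
`(Δ(G)+2)`-choosable: for every assignment of lists of at least `Δ(G) + 2` colors
to the vertices, there is an injective coloring choosing each color from the
corresponding list. -/
theorem injectively_choosable_of_maxDegree_ge_four {V : Type*} [Fintype V]
    (G : SimpleGraph V) [DecidableRel G.Adj]
    (hΔ : 4 ≤ G.maxDegree)
    (hmad : ∀ H : G.Subgraph, H.verts.Nonempty →
      (2 * H.edgeSet.ncard : ℚ) / H.verts.ncard < 14 / 5)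
    (L : V → Finset ℕ) (hL : ∀ v, G.maxDegree + 2 ≤ (L v).card) :
    ∃ c : V → ℕ, (∀ v, c v ∈ L v) ∧ IsInjColoring G c := by
  classical
  exact InjChoosable.exists_injColoring_of_le hΔ hmad hL G le_rfl
end
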